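/- arXiv:1306.1877 — 7 statements merged into one kernel-verified Lean document; each statement's English description precedes it below -/
import Mathlib

section
/- Let f : X × Y → {-1,1} be a boolean function on finite nonempty sets with rank(f) = r ≥ 1. Then disc(f) ≥ 1/(8·√r). -/
open Finset

/-- The discrepancy of `f` with respect to the distribution `μ`:
the maximal bias `|∑_{(x,y)∈R} μ(x,y) f(x,y)|` over all rectangles `R = A × B`. -/
noncomputable def discMu {X Y : Type} [Fintype X] [Fintype Y] (f μ : X × Y → ℝ) : ℝ :=
  sSup { d : ℝ | ∃ (A : Finset X) (B : Finset Y),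
    d = |∑ x ∈ A, ∑ y ∈ B, μ (x, y) * f (x, y)| }

/-- The discrepancy of `f`: the minimum over probability distributions `μ` on `X × Y`
of `discMu f μ`. -/
noncomputable def disc {X Y : Type} [Fintype X] [Fintype Y] (f : X × Y → ℝ) : ℝ :=
  sInf { d : ℝ | ∃ μ : X × Y → ℝ,
    (∀ p, 0 ≤ μ p) ∧ (∑ p, μ p = 1) ∧ d = discMu f μ }

open MeasureTheory

theorem aux_measurable_sign : Measurable Real.sign := by
  unfold Real.sign
  refine Measurable.ite measurableSet_Iio measurable_const ?_
  exact Measurable.ite measurableSet_Ioi measurable_const measurable_const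

theorem aux_sign_abs_le (x : ℝ) : |Real.sign x| ≤ 1 := by
  rcases Real.sign_apply_eq x with h | h | h <;> rw [h] <;> norm_num

/-- pointwise inequality -/
theorem aux_sign_ineq (a b t s : ℝ) (ht : 0 ≤ t) (hs : 0 ≤ s) (hs1 : s ≤ 1) :
    (if |b| < t * |a| then (2 : ℝ) else 0) ≤
      Real.sign a * Real.sign (t * a + s * b) + Real.sign a * Real.sign (t * a + s * (-b)) := by
  have hsb : |s * b| ≤ |b| := by
    rw [abs_mul, abs_of_nonneg hs]
    nlinarith [abs_nonneg b]
  have key : ∀ c d : ℝ, 0 ≤ c → (if |d| < c then (2 : ℝ) else 0) ≤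
      Real.sign (c + d) + Real.sign (c + -d) := by
    intro c d hc
    split_ifs with h
    · rw [abs_lt] at h
      rw [Real.sign_of_pos (by linarith), Real.sign_of_pos (by linarith)]; norm_num
    · rcases lt_trichotomy (c + d) 0 with h1 | h1 | h1
      · rw [Real.sign_of_neg h1, Real.sign_of_pos (by linarith)]; norm_num
      · rw [h1, Real.sign_zero]
        rcases lt_trichotomy (c + -d) 0 with h2 | h2 | h2
        · linarith
        · rw [h2, Real.sign_zero]; norm_num
        · rw [Real.sign_of_pos h2]; norm_num
      · rw [Real.sign_of_pos h1]
        rcases Real.sign_apply_eq (c + -d) with h | h | h <;> rw [h] <;> norm_num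
  rcases lt_trichotomy a 0 with ha | ha | ha
  · have := key (t * |a|) (s * b) (by positivity)
    rw [abs_of_neg ha] at this ⊢
    rw [Real.sign_of_neg ha]
    have e1 : t * a + s * b = -(t * -a + -(s * b)) := by ring
    have e2 : t * a + s * -b = -(t * -a + (s * b)) := by ring
    rw [e1, e2, Real.sign_neg, Real.sign_neg]
    refine le_trans ?_ (this.trans (by linarith))
    split_ifs <;> linarith
  · subst ha
    simp [not_lt.mpr (abs_nonneg b)]
  · have := key (t * |a|) (s * b) (by positivity)
    rw [abs_of_pos ha] at this ⊢
    rw [Real.sign_of_pos ha]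
    have e2 : t * a + s * -b = t * a + -(s * b) := by ring
    rw [e2]
    refine le_trans ?_ (this.trans (by linarith))
    split_ifs <;> linarith

section Sphere
variable {F : Type} [NormedAddCommGroup F] [InnerProductSpace ℝ F] [FiniteDimensional ℝ F]
  [MeasurableSpace F] [BorelSpace F]

theorem aux_meas_inner (v : F) : Measurable (fun g : F => (inner ℝ v g : ℝ)) := by
  fun_prop

theorem aux_null (v : F) (hv : v ≠ 0) : (volume : Measure F) {g | inner ℝ v g = 0} = 0 := by
  have : {g : F | inner ℝ v g = 0} = ((ℝ ∙ v)ᗮ : Submodule ℝ F) := by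
    ext g
    simp [Submodule.mem_orthogonal_singleton_iff_inner_right]
  rw [this]
  apply Measure.addHaar_submodule
  intro h
  have : v ∈ (ℝ ∙ v)ᗮ := by rw [h]; trivial
  rw [Submodule.mem_orthogonal_singleton_iff_inner_right] at this
  exact hv (inner_self_eq_zero.mp this)

theorem aux_int (v u : F) : IntegrableOn
    (fun g : F => Real.sign (inner ℝ v g) * Real.sign (inner ℝ u g)) (Metric.ball 0 1) := by
  apply Measure.integrableOn_of_bounded (M := 1)
  · exact measure_ball_lt_top.ne
  · apply Measurable.aestronglyMeasurable
    exact (aux_measurable_sign.comp (aux_meas_inner v)).mul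
      (aux_measurable_sign.comp (aux_meas_inner u))
  · refine Filter.Eventually.of_forall fun g => ?_
    rw [Real.norm_eq_abs, abs_mul]
    exact mul_le_one₀ (aux_sign_abs_le _) (abs_nonneg _) (aux_sign_abs_le _)

theorem aux_invol (R : F ≃ₗᵢ[ℝ] F) (h : F → ℝ) :
    ∫ g in Metric.ball (0 : F) 1, h (R g) = ∫ g in Metric.ball (0 : F) 1, h g := by
  have := R.measurePreserving.setIntegral_preimage_emb R.toHomeomorph.measurableEmbedding h
    (Metric.ball 0 1)
  rwa [LinearIsometryEquiv.preimage_ball, map_zero] at this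

/-- volume of half cone -/
theorem aux_half (v w : F) (hv : ‖v‖ = 1) (hw : ‖w‖ = 1) (hvw : inner ℝ v w = 0) :
    (volume : Measure F).real (Metric.ball 0 1) ≤
      2 * (volume : Measure F).real
        (Metric.ball 0 1 ∩ {g | |(inner ℝ w g : ℝ)| < |(inner ℝ v g : ℝ)|}) := by
  set S := Metric.ball (0:F) 1 ∩ {g | |(inner ℝ w g : ℝ)| < |(inner ℝ v g : ℝ)|} with hS
  set S' := Metric.ball (0:F) 1 ∩ {g | |(inner ℝ v g : ℝ)| < |(inner ℝ w g : ℝ)|} with hS'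
  let R : F ≃ₗᵢ[ℝ] F := Submodule.reflection (ℝ ∙ (v - w))ᗮ
  have hRv : R v = w := Submodule.reflection_sub (by rw [hv, hw])
  have hRR : ∀ x, R (R x) = x := fun x => Submodule.reflection_reflection _ x
  have hRw : R w = v := by rw [← hRv, hRR]
  have hpre : R ⁻¹' S = S' := by
    ext g
    have h1 : (inner ℝ w (R g) : ℝ) = inner ℝ v g := by
      rw [← hRv, LinearIsometryEquiv.inner_map_map]
    have h2 : (inner ℝ v (R g) : ℝ) = inner ℝ w g := by
      rw [← hRw, LinearIsometryEquiv.inner_map_map]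
    simp [hS, hS', h1, h2]
  have hSm : MeasurableSet S := by
    apply measurableSet_ball.inter
    exact measurableSet_lt (aux_meas_inner w).abs (aux_meas_inner v).abs
  have heq : (volume : Measure F) S' = volume S := by
    rw [← hpre]
    exact R.measurePreserving.measure_preimage hSm.nullMeasurableSet
  have hne1 : v - w ≠ 0 := by
    intro h
    rw [sub_eq_zero] at h
    rw [← h, real_inner_self_eq_norm_sq, hv] at hvw
    norm_num at hvw
  have hne2 : v + w ≠ 0 := by
    intro h
    have h' : w = -v := by rw [eq_neg_iff_add_eq_zero, add_comm]; exact h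
    rw [h', inner_neg_right, real_inner_self_eq_norm_sq, hv] at hvw
    norm_num at hvw
  have hsub : Metric.ball (0:F) 1 ⊆ (S ∪ S') ∪
      ({g | inner ℝ (v - w) g = 0} ∪ {g | inner ℝ (v + w) g = 0}) := by
    intro g hg
    rcases lt_trichotomy |(inner ℝ w g : ℝ)| |(inner ℝ v g : ℝ)| with h | h | h
    · exact Or.inl (Or.inl ⟨hg, h⟩)
    · right
      rcases abs_eq_abs.mp h with h | h
      · left; simp [inner_sub_left, h]
      · right; simp [inner_add_left, h]
    · exact Or.inl (Or.inr ⟨hg, h⟩)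
  have hfin : volume S ≠ ⊤ :=
    ((measure_mono Set.inter_subset_left).trans_lt measure_ball_lt_top).ne
  have hle : (volume : Measure F) (Metric.ball 0 1) ≤ 2 * volume S := by
    calc (volume : Measure F) (Metric.ball 0 1) ≤ _ := measure_mono hsub
      _ ≤ _ := measure_union_le _ _
      _ ≤ (volume S + volume S') + (volume {g : F | inner ℝ (v - w) g = 0} +
          volume {g : F | inner ℝ (v + w) g = 0}) :=
        add_le_add (measure_union_le _ _) (measure_union_le _ _)
      _ = 2 * volume S := by rw [aux_null _ hne1, aux_null _ hne2, heq]; ring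
  have := ENNReal.toReal_mono (ENNReal.mul_ne_top (by simp) hfin) hle
  simpa [Measure.real] using this

theorem aux_shrink (v w : F) (hw : ‖w‖ = 1) (hvw : inner ℝ v w = 0)
    (t : ℝ) (ht : 0 < t) (ht1 : t ≤ 1) :
    t * (volume : Measure F).real
        (Metric.ball 0 1 ∩ {g | |(inner ℝ w g : ℝ)| < |(inner ℝ v g : ℝ)|}) ≤
      (volume : Measure F).real
        (Metric.ball 0 1 ∩ {g | |(inner ℝ w g : ℝ)| < t * |(inner ℝ v g : ℝ)|}) := by
  set S := Metric.ball (0:F) 1 ∩ {g | |(inner ℝ w g : ℝ)| < |(inner ℝ v g : ℝ)|} with hS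
  set S' := Metric.ball (0:F) 1 ∩ {g | |(inner ℝ w g : ℝ)| < t * |(inner ℝ v g : ℝ)|} with hS'
  let T : F →ₗ[ℝ] F := LinearMap.transvection (innerSL ℝ w).toLinearMap ((t - 1) • w)
  have hT : ∀ g, T g = g + (inner ℝ w g * (t - 1)) • w := by
    intro g
    simp [T, LinearMap.transvection.apply, smul_smul]
  have hdet : LinearMap.det T = t := by
    simp [T, inner_smul_right, hw]
  have himg : T '' S ⊆ S' := by
    rintro _ ⟨g, ⟨hg, hg2⟩, rfl⟩
    have hg2' : |(inner ℝ w g : ℝ)| < |(inner ℝ v g : ℝ)| := hg2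
    have h1 : (inner ℝ w (T g) : ℝ) = t * inner ℝ w g := by
      rw [hT, inner_add_right, inner_smul_right, real_inner_self_eq_norm_sq, hw]; ring
    have h2 : (inner ℝ v (T g) : ℝ) = inner ℝ v g := by
      rw [hT, inner_add_right, inner_smul_right, hvw]; ring
    refine ⟨?_, ?_⟩
    · rw [mem_ball_zero_iff] at hg ⊢
      have : ‖T g‖ ^ 2 ≤ ‖g‖ ^ 2 := by
        rw [hT, norm_add_sq_real, inner_smul_right, norm_smul, hw, real_inner_comm w g, mul_one,
          Real.norm_eq_abs, sq_abs]
        have : 0 ≤ (inner ℝ w g : ℝ) ^ 2 * ((1 - t) * (1 + t)) :=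
          mul_nonneg (sq_nonneg _) (mul_nonneg (by linarith) (by linarith))
        nlinarith
      exact (le_of_sq_le_sq this (norm_nonneg _)).trans_lt hg
    · show |(inner ℝ w (T g) : ℝ)| < t * |(inner ℝ v (T g) : ℝ)|
      rw [h1, h2, abs_mul, abs_of_pos ht]
      exact mul_lt_mul_of_pos_left hg2' ht
  have hfin : volume S' ≠ ⊤ :=
    ((measure_mono Set.inter_subset_left).trans_lt measure_ball_lt_top).ne
  have hle := measure_mono (μ := (volume : Measure F)) himg
  rw [Measure.addHaar_image_linearMap, hdet, abs_of_pos ht] at hle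
  have := ENNReal.toReal_mono hfin hle
  simpa [Measure.real, ENNReal.toReal_mul, ht.le] using this

theorem aux_main_orth (v w : F) (hv : ‖v‖ = 1) (hw : ‖w‖ = 1) (hvw : inner ℝ v w = 0)
    (t s : ℝ) (ht : 0 < t) (ht1 : t ≤ 1) (hs : 0 ≤ s) (hs1 : s ≤ 1) :
    t / 2 * (volume : Measure F).real (Metric.ball 0 1) ≤
      ∫ g in Metric.ball (0 : F) 1,
        Real.sign (inner ℝ v g) * Real.sign (inner ℝ (t • v + s • w) g) := by
  have h1 := aux_half v w hv hw hvw
  have h2 := aux_shrink v w hw hvw t ht ht1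
  set I := ∫ g in Metric.ball (0 : F) 1,
        Real.sign (inner ℝ v g) * Real.sign (inner ℝ (t • v + s • w) g) with hI
  let R : F ≃ₗᵢ[ℝ] F := Submodule.reflection (ℝ ∙ w)ᗮ
  have hRw : R w = -w := Submodule.reflection_orthogonalComplement_singleton_eq_neg w
  have hRv : R v = v := by
    apply Submodule.reflection_mem_subspace_eq_self
    rw [Submodule.mem_orthogonal_singleton_iff_inner_left]
    exact hvw
  have hI2 : ∫ g in Metric.ball (0 : F) 1,
        Real.sign (inner ℝ v g) * Real.sign (inner ℝ (t • v + s • (-w)) g) = I := by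
    rw [hI, ← aux_invol R (fun g => Real.sign (inner ℝ v g) * Real.sign (inner ℝ (t • v + s • w) g))]
    congr 1
    ext g
    have e1 : (inner ℝ v (R g) : ℝ) = inner ℝ v g := by
      conv_lhs => rw [← hRv]
      rw [LinearIsometryEquiv.inner_map_map]
    have e2 : (inner ℝ (t • v + s • w) (R g) : ℝ) = inner ℝ (t • v + s • (-w)) g := by
      rw [← LinearIsometryEquiv.inner_map_map R (t • v + s • (-w)) g]
      simp [hRv, hRw]
    rw [e1, e2]
  have hSm : MeasurableSet {g : F | |(inner ℝ w g : ℝ)| < t * |(inner ℝ v g : ℝ)|} :=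
    measurableSet_lt (aux_meas_inner w).abs ((aux_meas_inner v).abs.const_mul t)
  have h3 : 2 * (volume : Measure F).real
        (Metric.ball 0 1 ∩ {g | |(inner ℝ w g : ℝ)| < t * |(inner ℝ v g : ℝ)|}) ≤ I + I := by
    nth_rewrite 2 [← hI2]
    rw [hI, ← integral_add (aux_int _ _) (aux_int _ _)]
    have e : 2 * (volume : Measure F).real
        (Metric.ball 0 1 ∩ {g | |(inner ℝ w g : ℝ)| < t * |(inner ℝ v g : ℝ)|}) =
        ∫ g in Metric.ball (0 : F) 1, Set.indicator
          {g : F | |(inner ℝ w g : ℝ)| < t * |(inner ℝ v g : ℝ)|} (fun _ => (2:ℝ)) g := by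
      rw [integral_indicator hSm, setIntegral_const, measureReal_restrict_apply hSm,
        Set.inter_comm, smul_eq_mul, mul_comm]
    rw [e]
    apply integral_mono
    · haveI : IsFiniteMeasure ((volume : Measure F).restrict (Metric.ball 0 1)) :=
        ⟨by simpa using measure_ball_lt_top⟩
      exact (integrable_const (2:ℝ)).indicator hSm
    · exact (aux_int _ _).add (aux_int _ _)
    · intro g
      have := aux_sign_ineq (inner ℝ v g) (inner ℝ w g) t s ht.le hs hs1
      simpa [Set.indicator_apply, inner_add_left, inner_smul_left] using this
  nlinarith

theorem aux_main_unit (v u : F) (hv : ‖v‖ = 1) (hu : ‖u‖ = 1) (ht : 0 < (inner ℝ v u : ℝ)) :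
    (inner ℝ v u : ℝ) / 2 * (volume : Measure F).real (Metric.ball 0 1) ≤
      ∫ g in Metric.ball (0 : F) 1, Real.sign (inner ℝ v g) * Real.sign (inner ℝ u g) := by
  set t : ℝ := inner ℝ v u with htdef
  have ht1 : t ≤ 1 := by
    have := real_inner_le_norm v u
    rwa [hv, hu, mul_one] at this
  set w' : F := u - t • v with hw'
  have hvw' : (inner ℝ v w' : ℝ) = 0 := by
    rw [hw', inner_sub_right, inner_smul_right, real_inner_self_eq_norm_sq, hv, ← htdef]; ring
  have hnorm : ‖w'‖ ≤ 1 := by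
    have e : u = t • v + w' := by rw [hw']; abel
    have h2 : ‖u‖ ^ 2 = t ^ 2 + ‖w'‖ ^ 2 := by
      rw [e, norm_add_sq_real, inner_smul_left, hvw', norm_smul, hv, Real.norm_eq_abs, mul_one,
        sq_abs]; simp
    rw [hu] at h2
    nlinarith [sq_nonneg t, norm_nonneg w']
  by_cases hz : w' = 0
  · have hut : u = t • v := by rw [hw', sub_eq_zero] at hz; exact hz
    have hne : v ≠ 0 := by intro h; rw [h, norm_zero] at hv; norm_num at hv
    have hae : ∀ᵐ g ∂((volume : Measure F).restrict (Metric.ball 0 1)),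
        Real.sign (inner ℝ v g) * Real.sign (inner ℝ u g) = 1 := by
      apply ae_restrict_of_ae
      have := aux_null v hne
      have h0 : ∀ᵐ g ∂(volume : Measure F), (inner ℝ v g : ℝ) ≠ 0 := by
        rw [ae_iff]; simpa using this
      filter_upwards [h0] with g hg
      rw [hut, inner_smul_left]
      simp only [conj_trivial]
      rcases lt_or_gt_of_ne hg with h | h
      · rw [Real.sign_of_neg h, Real.sign_of_neg (mul_neg_of_pos_of_neg ht h)]; norm_num
      · rw [Real.sign_of_pos h, Real.sign_of_pos (mul_pos ht h)]; norm_num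
    rw [integral_congr_ae hae, setIntegral_const, smul_eq_mul, mul_one]
    have : 0 ≤ (volume : Measure F).real (Metric.ball 0 1) := measureReal_nonneg
    nlinarith
  · have hpos : 0 < ‖w'‖ := norm_pos_iff.mpr hz
    have := aux_main_orth v (‖w'‖⁻¹ • w') hv
      (by rw [norm_smul, norm_inv, norm_norm, inv_mul_cancel₀ hpos.ne'])
      (by rw [inner_smul_right, hvw', mul_zero]) t ‖w'‖ ht ht1 hpos.le hnorm
    rw [smul_smul, mul_inv_cancel₀ hpos.ne', one_smul] at this
    have e : t • v + w' = u := by rw [hw']; abel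
    rwa [e] at this

/-- general sign-correlation bound -/
theorem aux_main (v u : F) (hv : ‖v‖ = 1) (c : ℝ) (hc : c = 1 ∨ c = -1) (p : ℝ) (hp : 0 < p)
    (h : inner ℝ u v = p * c) :
    p / ‖u‖ / 2 * (volume : Measure F).real (Metric.ball 0 1) ≤
      c * ∫ g in Metric.ball (0 : F) 1, Real.sign (inner ℝ u g) * Real.sign (inner ℝ v g) := by
  have hc2 : c * c = 1 := by rcases hc with h | h <;> rw [h] <;> norm_num
  have hcn : ‖c‖ = 1 := by rcases hc with h | h <;> rw [h] <;> norm_num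
  have hune : u ≠ 0 := by
    rintro rfl
    rw [inner_zero_left] at h
    rcases hc with h' | h' <;> rw [h'] at h <;> linarith
  have hupos : 0 < ‖u‖ := norm_pos_iff.mpr hune
  have hin : (inner ℝ (‖u‖⁻¹ • u) (c • v) : ℝ) = p / ‖u‖ := by
    rw [inner_smul_left, inner_smul_right, h]
    simp only [conj_trivial]
    calc ‖u‖⁻¹ * (c * (p * c)) = ‖u‖⁻¹ * p * (c * c) := by ring
      _ = p / ‖u‖ := by rw [hc2]; field_simp
  have := aux_main_unit (‖u‖⁻¹ • u) (c • v)
    (by rw [norm_smul, norm_inv, norm_norm, inv_mul_cancel₀ hupos.ne'])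
    (by rw [norm_smul, hcn, hv, mul_one]) (by rw [hin]; positivity)
  rw [hin] at this
  refine this.trans (le_of_eq ?_)
  rw [← integral_const_mul]
  congr 1
  ext g
  have e1 : Real.sign (inner ℝ (‖u‖⁻¹ • u) g) = Real.sign (inner ℝ u g) := by
    rw [inner_smul_left]
    simp only [conj_trivial]
    have hi : 0 < ‖u‖⁻¹ := inv_pos.mpr hupos
    rcases lt_trichotomy (inner ℝ u g : ℝ) 0 with h | h | h
    · rw [Real.sign_of_neg h, Real.sign_of_neg (mul_neg_of_pos_of_neg hi h)]
    · rw [h, mul_zero]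
    · rw [Real.sign_of_pos h, Real.sign_of_pos (mul_pos hi h)]
  have e2 : Real.sign (inner ℝ (c • v) g) = c * Real.sign (inner ℝ v g) := by
    rw [inner_smul_left]
    simp only [conj_trivial]
    rcases hc with h | h <;> rw [h] <;> simp [Real.sign_neg]
  rw [e1, e2]; ring

end Sphere

/-- rectangles to sign vectors -/
theorem aux_rect {X Y : Type} [Fintype X] [Fintype Y] (f μ : X × Y → ℝ) (a : X → ℝ) (b : Y → ℝ) :
    ∑ x, ∑ y, μ (x, y) * f (x, y) * (Real.sign (a x) * Real.sign (b y)) ≤ 4 * discMu f μ := by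
  classical
  have hbdd : BddAbove { d : ℝ | ∃ (A : Finset X) (B : Finset Y),
      d = |∑ x ∈ A, ∑ y ∈ B, μ (x, y) * f (x, y)| } := by
    apply Set.Finite.bddAbove
    have : { d : ℝ | ∃ (A : Finset X) (B : Finset Y),
      d = |∑ x ∈ A, ∑ y ∈ B, μ (x, y) * f (x, y)| } = Set.range
        (fun q : Finset X × Finset Y => |∑ x ∈ q.1, ∑ y ∈ q.2, μ (x, y) * f (x, y)|) := by
      ext d
      simp [eq_comm]
    rw [this]
    exact Set.finite_range _
  have hle : ∀ (A : Finset X) (B : Finset Y),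
      |∑ x ∈ A, ∑ y ∈ B, μ (x, y) * f (x, y)| ≤ discMu f μ :=
    fun A B => le_csSup hbdd ⟨A, B, rfl⟩
  have hs : ∀ z : ℝ, Real.sign z = (if 0 < z then 1 else 0) - (if z < 0 then 1 else 0) := by
    intro z
    rcases lt_trichotomy z 0 with h | h | h
    · rw [Real.sign_of_neg h]; simp [h, h.le, not_lt.mpr h.le]
    · simp [h]
    · rw [Real.sign_of_pos h]; simp [h, h.le, not_lt.mpr h.le]
  let Ap := univ.filter fun x => 0 < a x
  let An := univ.filter fun x => a x < 0
  let Bp := univ.filter fun y => 0 < b y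
  let Bn := univ.filter fun y => b y < 0
  have e : ∑ x, ∑ y, μ (x, y) * f (x, y) * (Real.sign (a x) * Real.sign (b y)) =
      (∑ x ∈ Ap, ∑ y ∈ Bp, μ (x, y) * f (x, y)) - (∑ x ∈ Ap, ∑ y ∈ Bn, μ (x, y) * f (x, y))
      - (∑ x ∈ An, ∑ y ∈ Bp, μ (x, y) * f (x, y)) + (∑ x ∈ An, ∑ y ∈ Bn, μ (x, y) * f (x, y)) := by
    simp only [Ap, An, Bp, Bn, sum_filter]
    rw [← sum_sub_distrib, ← sum_sub_distrib, ← sum_add_distrib]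
    refine sum_congr rfl fun x _ => ?_
    rw [hs (a x)]
    have : ∀ y, μ (x, y) * f (x, y) * (((if 0 < a x then 1 else 0) - (if a x < 0 then 1 else 0)) *
        Real.sign (b y)) = ((if 0 < a x then 1 else 0) - (if a x < 0 then 1 else 0)) *
        ((if 0 < b y then μ (x, y) * f (x, y) else 0) -
          (if b y < 0 then μ (x, y) * f (x, y) else 0)) := by
      intro y
      rw [hs (b y)]
      split_ifs <;> ring
    rw [sum_congr rfl fun y _ => this y, ← mul_sum, sum_sub_distrib]
    split_ifs <;> ring
  rw [e]
  have h1 := abs_le.mp (hle Ap Bp)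
  have h2 := abs_le.mp (hle Ap Bn)
  have h3 := abs_le.mp (hle An Bp)
  have h4 := abs_le.mp (hle An Bn)
  linarith [h1.2, h2.1, h3.1, h4.2]

/-- factorization in isotropic position -/
theorem aux_factor {X Y : Type} [Fintype X] [Fintype Y]
    (f : X × Y → ℝ) (hf : ∀ q, f q = 1 ∨ f q = -1)
    (r : ℕ) (hr : (Matrix.of fun x y => f (x, y)).rank = r)
    (p : X → ℝ) (hp : ∀ x, 0 ≤ p x) (hp1 : ∑ x, p x = 1) :
    ∃ (d : ℕ) (u : X → EuclideanSpace ℝ (Fin d)) (v : Y → EuclideanSpace ℝ (Fin d)),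
      d ≤ r ∧ (∀ y, ‖v y‖ = 1) ∧ (∀ x y, inner ℝ (u x) (v y) = Real.sqrt (p x) * f (x, y)) ∧
      ∑ x, ‖u x‖ ^ 2 = d := by
  classical
  let V : Y → EuclideanSpace ℝ X := fun y => WithLp.toLp 2 fun x => Real.sqrt (p x) * f (x, y)
  let E : Submodule ℝ (EuclideanSpace ℝ X) := Submodule.span ℝ (Set.range V)
  let b := stdOrthonormalBasis ℝ E
  have hVE : ∀ y, V y ∈ E := fun y => Submodule.subset_span ⟨y, rfl⟩
  refine ⟨Module.finrank ℝ E, fun x => WithLp.toLp 2 fun i => (b i : EuclideanSpace ℝ X) x,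
    fun y => b.repr ⟨V y, hVE y⟩, ?_, ?_, ?_, ?_⟩
  · let M : Matrix X Y ℝ := Matrix.of fun x y => f (x, y)
    have h1 : (Matrix.diagonal (fun x => Real.sqrt (p x)) * M).rank ≤ r :=
      hr ▸ Matrix.rank_mul_le_right _ _
    rw [Matrix.rank_eq_finrank_span_cols] at h1
    refine le_trans (le_of_eq ?_) h1
    have h2 : Submodule.span ℝ (Set.range (Matrix.diagonal (fun x => Real.sqrt (p x)) * M).col) =
        E.map (WithLp.linearEquiv 2 ℝ (X → ℝ)).toLinearMap := by
      rw [Submodule.map_span, ← Set.range_comp]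
      congr 2
      ext y x
      simp [V, M, Matrix.diagonal_mul]
    rw [h2]
    exact (LinearEquiv.finrank_map_eq _ _).symm
  · intro y
    rw [LinearIsometryEquiv.norm_map, Submodule.coe_norm]
    have : ‖V y‖ ^ 2 = 1 := by
      rw [EuclideanSpace.norm_sq_eq, ← hp1]
      refine sum_congr rfl fun x _ => ?_
      simp only [V, Real.norm_eq_abs, sq_abs, mul_pow, Real.sq_sqrt (hp x)]
      rcases hf (x, y) with h | h <;> rw [h] <;> norm_num
    nlinarith [norm_nonneg (V y)]
  · intro x y
    have h := congrArg (fun z : E => (z : EuclideanSpace ℝ X) x) (b.sum_repr ⟨V y, hVE y⟩)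
    simp only [Submodule.coe_sum, Submodule.coe_smul, WithLp.ofLp_sum, Finset.sum_apply,
      WithLp.ofLp_smul, Pi.smul_apply, smul_eq_mul] at h
    rw [PiLp.inner_apply]
    simpa [V] using h
  · simp only [EuclideanSpace.norm_sq_eq]
    rw [sum_comm]
    have : ∀ i, ∑ x, ‖(b i : EuclideanSpace ℝ X) x‖ ^ 2 = 1 := by
      intro i
      rw [← EuclideanSpace.norm_sq_eq, ← Submodule.coe_norm, b.norm_eq_one, one_pow]
    rw [Finset.sum_congr rfl fun i _ => this i]
    simp

theorem aux_tangent (p n r : ℝ) (hp : 0 < p) (hn : 0 < n) (hr : 0 < r) :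
    3 / 2 * p / r - n ^ 2 / (2 * r ^ 3) ≤ p * (Real.sqrt p / n) := by
  set q := Real.sqrt p with hq
  have hq0 : 0 < q := Real.sqrt_pos.mpr hp
  have hpq : p = q ^ 2 := (Real.sq_sqrt hp.le).symm
  rw [hpq]
  have key : 0 ≤ (r * q - n) ^ 2 * (2 * (r * q) + n) := by positivity
  have e : q ^ 2 * (q / n) - (3 / 2 * q ^ 2 / r - n ^ 2 / (2 * r ^ 3)) =
      (r * q - n) ^ 2 * (2 * (r * q) + n) / (2 * r ^ 3 * n) := by
    field_simp
    ring
  have : 0 ≤ (r * q - n) ^ 2 * (2 * (r * q) + n) / (2 * r ^ 3 * n) := by positivity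
  linarith

theorem aux_discMu {X Y : Type} [Fintype X] [Fintype Y]
    (f : X × Y → ℝ) (hf : ∀ p, f p = 1 ∨ f p = -1)
    (r : ℕ) (hr : (Matrix.of fun x y => f (x, y)).rank = r) (hr1 : 1 ≤ r)
    (μ : X × Y → ℝ) (h0 : ∀ q, 0 ≤ μ q) (h1 : ∑ q, μ q = 1) :
    1 / (8 * Real.sqrt r) ≤ discMu f μ := by
  let p : X → ℝ := fun x => ∑ y, μ (x, y)
  have hp : ∀ x, 0 ≤ p x := fun x => sum_nonneg fun y _ => h0 _
  have hp1 : ∑ x, p x = 1 := by rw [← h1, Fintype.sum_prod_type]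
  obtain ⟨d, u, v, hd, hv, huv, hu⟩ := aux_factor f hf r hr p hp hp1
  set B := (volume : Measure (EuclideanSpace ℝ (Fin d))).real (Metric.ball 0 1) with hB
  have hBpos : 0 < B := ENNReal.toReal_pos (Metric.measure_ball_pos _ _ one_pos).ne'
    measure_ball_lt_top.ne
  set s := Real.sqrt r with hs
  have hspos : 0 < s := Real.sqrt_pos.mpr (by exact_mod_cast hr1)
  have hs2 : s ^ 2 = r := Real.sq_sqrt (by positivity)
  have hmu0 : ∀ x, p x = 0 → ∀ y, μ (x, y) = 0 := fun x hx y =>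
    (sum_eq_zero_iff_of_nonneg (fun y _ => h0 (x, y))).mp hx y (mem_univ y)
  -- upper bound
  have hup : ∑ x, ∑ y, μ (x, y) * f (x, y) * (∫ g in Metric.ball (0 : EuclideanSpace ℝ (Fin d)) 1,
      Real.sign (inner ℝ (u x) g) * Real.sign (inner ℝ (v y) g)) ≤ 4 * discMu f μ * B := by
    have e : ∑ x, ∑ y, μ (x, y) * f (x, y) *
        (∫ g in Metric.ball (0 : EuclideanSpace ℝ (Fin d)) 1,
        Real.sign (inner ℝ (u x) g) * Real.sign (inner ℝ (v y) g)) =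
        ∫ g in Metric.ball (0 : EuclideanSpace ℝ (Fin d)) 1, ∑ x, ∑ y, μ (x, y) * f (x, y) *
        (Real.sign (inner ℝ (u x) g) * Real.sign (inner ℝ (v y) g)) := by
      rw [integral_finsetSum]
      · refine sum_congr rfl fun x _ => ?_
        rw [integral_finsetSum]
        · refine sum_congr rfl fun y _ => ?_
          rw [integral_const_mul]
        · exact fun y _ => (aux_int _ _).const_mul _
      · exact fun x _ => integrable_finsetSum _ fun y _ => (aux_int _ _).const_mul _
    rw [e]
    have e2 : 4 * discMu f μ * B = ∫ g in Metric.ball (0 : EuclideanSpace ℝ (Fin d)) 1,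
        4 * discMu f μ := by
      rw [setIntegral_const, smul_eq_mul, mul_comm]
    rw [e2]
    apply integral_mono
    · exact integrable_finsetSum _ fun x _ => integrable_finsetSum _ fun y _ =>
        (aux_int _ _).const_mul _
    · exact integrableOn_const measure_ball_lt_top.ne
    · intro g
      exact aux_rect f μ _ _
  have hlow : ∀ x, (3 / 2 * p x / s - ‖u x‖ ^ 2 / (2 * s ^ 3)) * (B / 2) ≤
      ∑ y, μ (x, y) * f (x, y) * (∫ g in Metric.ball (0 : EuclideanSpace ℝ (Fin d)) 1,
      Real.sign (inner ℝ (u x) g) * Real.sign (inner ℝ (v y) g)) := by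
    intro x
    rcases (hp x).eq_or_lt with hx | hx
    · rw [sum_eq_zero fun y _ => by rw [hmu0 x hx.symm y]; ring, ← hx]
      have : 0 ≤ ‖u x‖ ^ 2 / (2 * s ^ 3) := by positivity
      apply mul_nonpos_of_nonpos_of_nonneg _ (by positivity)
      simp only [mul_zero, zero_div]
      linarith
    · have hterm : ∀ y, μ (x, y) * (Real.sqrt (p x) / ‖u x‖ / 2 * B) ≤
          μ (x, y) * f (x, y) * (∫ g in Metric.ball (0 : EuclideanSpace ℝ (Fin d)) 1,
          Real.sign (inner ℝ (u x) g) * Real.sign (inner ℝ (v y) g)) := by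
        intro y
        rw [mul_assoc (μ (x, y)) (f (x, y))]
        exact mul_le_mul_of_nonneg_left (aux_main (v y) (u x) (hv y) (f (x, y)) (hf _) _
          (Real.sqrt_pos.mpr hx) (huv x y)) (h0 _)
      have hupos : 0 < ‖u x‖ := by
        rw [norm_pos_iff]
        intro hu0
        obtain ⟨y, -, hy⟩ : ∃ y ∈ (univ : Finset Y), μ (x, y) ≠ 0 :=
          exists_ne_zero_of_sum_ne_zero hx.ne'
        have := huv x y
        rw [hu0, inner_zero_left] at this
        have h2 := Real.sqrt_pos.mpr hx
        rcases hf (x, y) with h | h <;> rw [h] at this <;> linarith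
      refine le_trans ?_ (sum_le_sum fun y _ => hterm y)
      rw [← sum_mul]
      have := aux_tangent (p x) ‖u x‖ s hx hupos hspos
      calc _ ≤ p x * (Real.sqrt (p x) / ‖u x‖) * (B / 2) :=
            mul_le_mul_of_nonneg_right this (by positivity)
        _ = _ := by ring
  have hsum := (sum_le_sum fun x (_ : x ∈ univ) => hlow x).trans hup
  rw [← sum_mul, sum_sub_distrib, ← sum_div, ← sum_div, ← mul_sum, hp1, hu] at hsum
  have hdr : (d : ℝ) / (2 * s ^ 3) ≤ 1 / (2 * s) := by
    have : (d : ℝ) ≤ s ^ 2 := by rw [hs2]; exact_mod_cast hd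
    rw [div_le_div_iff₀ (by positivity) (by positivity)]
    nlinarith
  have h5 : (1 / s) * (B / 2) ≤ 4 * discMu f μ * B := by
    refine le_trans (mul_le_mul_of_nonneg_right ?_ (by positivity)) hsum
    have : 1 / s = 3 / 2 * 1 / s - 1 / (2 * s) := by field_simp; norm_num
    linarith
  have h6 : 1 / (8 * s) * (4 * B) ≤ discMu f μ * (4 * B) := by
    calc _ = (1 / s) * (B / 2) := by field_simp; norm_num
      _ ≤ _ := h5
      _ = _ := by ring
  exact le_of_mul_le_mul_right h6 (by positivity)

/-- a boolean function of rank `r ≥ 1` on nonempty finite sets has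
discrepancy at least `1/(8√r)`. -/
theorem disc_ge_of_rank
    {X Y : Type} [Fintype X] [Fintype Y] [Nonempty X] [Nonempty Y]
    (f : X × Y → ℝ) (hf : ∀ p, f p = 1 ∨ f p = -1)
    (r : ℕ) (hr : (Matrix.of fun x y => f (x, y)).rank = r) (hr1 : 1 ≤ r) :
    disc f ≥ 1 / (8 * Real.sqrt r) := by
  classical
  apply le_csInf
  · obtain ⟨q⟩ : Nonempty (X × Y) := inferInstance
    refine ⟨_, fun z => if z = q then 1 else 0, ?_, ?_, rfl⟩
    · intro z; dsimp only; split_ifs <;> norm_num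
    · simp
  · rintro _ ⟨μ, h0, h1, rfl⟩
    exact aux_discMu f hf r hr hr1 μ h0 h1
end

section
/- There is an absolute constant C > 0 such that every boolean function f : X × Y → {-1,1} on finite nonempty sets with rank(f) = r ≥ 2 has a rectangle R on which f is constant with |R| ≥ 2^{-C·√r·log r}·|X × Y|. -/
open Finset

def GoodMat {X Y : Type} [Fintype X] [Fintype Y] (P : X → Y → ℝ) : Prop :=
  ∀ W : X → Y → ℝ, ∃ (A : Finset X) (B : Finset Y),
    ∑ x, ∑ y, W x y * P x y ≤ ∑ x ∈ A, ∑ y ∈ B, W x y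

section good
variable {X Y : Type} [Fintype X] [Fintype Y]

lemma goodMat_one : GoodMat (fun (_ : X) (_ : Y) => (1 : ℝ)) := by
  intro W
  exact ⟨univ, univ, by simp⟩

lemma goodMat_mul {P Q : X → Y → ℝ} (hP : GoodMat P) (hQ : GoodMat Q) :
    GoodMat (fun x y => P x y * Q x y) := by
  classical
  intro W
  obtain ⟨A, B, h⟩ := hQ (fun x y => W x y * P x y)
  obtain ⟨A', B', h'⟩ := hP (fun x y => if x ∈ A ∧ y ∈ B then W x y else 0)
  refine ⟨A' ∩ A, B' ∩ B, ?_⟩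
  have e1 : ∑ x ∈ A, ∑ y ∈ B, W x y * P x y
      = ∑ x, ∑ y, (if x ∈ A ∧ y ∈ B then W x y else 0) * P x y := by
    simp only [ite_and, ite_mul, zero_mul, Finset.sum_ite_irrel, Finset.sum_const_zero, Finset.sum_ite_mem, Finset.univ_inter]
  have e2 : ∑ x ∈ A', ∑ y ∈ B', (if x ∈ A ∧ y ∈ B then W x y else 0)
      = ∑ x ∈ A' ∩ A, ∑ y ∈ B' ∩ B, W x y := by
    simp only [ite_and, Finset.sum_ite_irrel, Finset.sum_const_zero, Finset.sum_ite_mem]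
  rw [e1] at h
  rw [e2] at h'
  refine le_trans (le_of_eq ?_) (h.trans h')
  simp only [mul_assoc]

lemma goodMat_pow {P : X → Y → ℝ} (hP : GoodMat P) (k : ℕ) :
    GoodMat (fun x y => P x y ^ k) := by
  induction k with
  | zero => simpa using goodMat_one
  | succ k ih => simpa [pow_succ] using goodMat_mul ih hP

lemma exists_sum_le_aux {ι : Type} [Fintype ι] (c a : ι → ℝ) (ha : ∀ i, 0 ≤ a i ∧ a i ≤ 1) :
    ∃ A : Finset ι, ∑ i, c i * a i ≤ ∑ i ∈ A, c i := by
  classical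
  refine ⟨univ.filter (fun i => 0 ≤ c i), ?_⟩
  rw [Finset.sum_filter]
  refine Finset.sum_le_sum fun i _ => ?_
  obtain ⟨h0, h1⟩ := ha i
  split_ifs with h
  · nlinarith
  · nlinarith

lemma goodMat_rank_one (a : X → ℝ) (b : Y → ℝ) (ha : ∀ i, 0 ≤ a i ∧ a i ≤ 1)
    (hb : ∀ i, 0 ≤ b i ∧ b i ≤ 1) : GoodMat (fun x y => a x * b y) := by
  intro W
  obtain ⟨A, hA⟩ := exists_sum_le_aux (fun x => ∑ y, W x y * b y) a ha
  obtain ⟨B, hB⟩ := exists_sum_le_aux (fun y => ∑ x ∈ A, W x y) b hb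
  refine ⟨A, B, ?_⟩
  calc ∑ x, ∑ y, W x y * (a x * b y) = ∑ x, (∑ y, W x y * b y) * a x := by
        simp only [Finset.sum_mul]
        refine Finset.sum_congr rfl fun x _ => Finset.sum_congr rfl fun y _ => by ring
    _ ≤ ∑ x ∈ A, ∑ y, W x y * b y := hA
    _ = ∑ y, (∑ x ∈ A, W x y) * b y := by
        rw [Finset.sum_comm]
        simp only [Finset.sum_mul]
    _ ≤ _ := hB
    _ = _ := Finset.sum_comm

open MeasureTheory in
lemma goodMat_integral {Ω : Type} [MeasurableSpace Ω] (μ : Measure Ω) [IsProbabilityMeasure μ]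
    (P : Ω → X → Y → ℝ) (hi : ∀ x y, Integrable (fun ω => P ω x y) μ)
    (hP : ∀ ω, GoodMat (P ω)) : GoodMat (fun x y => ∫ ω, P ω x y ∂μ) := by
  intro W
  have hint : Integrable (fun ω => ∑ x, ∑ y, W x y * P ω x y) μ :=
    integrable_finsetSum _ fun x _ => integrable_finsetSum _ fun y _ => (hi x y).const_mul _
  obtain ⟨ω, hω⟩ := exists_integral_le hint
  obtain ⟨A, B, h⟩ := hP ω W
  refine ⟨A, B, le_trans (le_of_eq ?_) (hω.trans h)⟩
  rw [integral_finsetSum _ fun x _ => integrable_finsetSum _ fun y _ => (hi x y).const_mul _]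
  refine Finset.sum_congr rfl fun x _ => ?_
  rw [integral_finsetSum _ fun y _ => (hi x y).const_mul _]
  refine Finset.sum_congr rfl fun y _ => ?_
  rw [integral_const_mul]

end good

section gauss
open MeasureTheory ProbabilityTheory
variable {E : Type} [NormedAddCommGroup E] [InnerProductSpace ℝ E] [FiniteDimensional ℝ E]
  [MeasurableSpace E] [BorelSpace E]

lemma integrable_bdd_aux (h : E → ℝ) (hc : Continuous h) (hb : ∀ x, |h x| ≤ 1) :
    Integrable h (stdGaussian E) :=
  Integrable.of_bound (C := 1) hc.aestronglyMeasurable (Filter.Eventually.of_forall hb)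

lemma integral_exp_aux (w : E) :
    ∫ g, Complex.exp ((inner ℝ g w : ℝ) * Complex.I) ∂(stdGaussian E)
      = ((Real.exp (-‖w‖^2/2) : ℝ) : ℂ) := by
  have := charFun_stdGaussian (E := E) w
  rw [charFun_apply] at this
  rw [this]
  push_cast
  rfl

lemma integrable_exp_aux (w : E) :
    Integrable (fun g => Complex.exp ((inner ℝ g w : ℝ) * Complex.I)) (stdGaussian E) := by
  refine Integrable.of_bound (C := 1) (Continuous.aestronglyMeasurable (by fun_prop))
    (Filter.Eventually.of_forall fun g => ?_)
  rw [Complex.norm_exp_ofReal_mul_I]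

lemma integral_cos_aux (w : E) :
    ∫ g, Real.cos (inner ℝ g w) ∂(stdGaussian E) = Real.exp (-‖w‖^2/2) := by
  have h := integral_exp_aux w
  have h2 := integral_re (𝕜 := ℂ) (integrable_exp_aux w)
  rw [h] at h2
  simpa [Complex.exp_ofReal_mul_I_re, -Complex.ofReal_exp] using h2

lemma integral_sin_aux (w : E) :
    ∫ g, Real.sin (inner ℝ g w) ∂(stdGaussian E) = 0 := by
  have h := integral_exp_aux w
  have h2 := integral_im (𝕜 := ℂ) (integrable_exp_aux w)
  rw [h] at h2
  simpa [Complex.exp_ofReal_mul_I_im, -Complex.ofReal_exp] using h2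

lemma integral_sin_mul_sin_aux (u v : E) :
    ∫ g, Real.sin (inner ℝ g u) * Real.sin (inner ℝ g v) ∂(stdGaussian E)
      = Real.exp (-(‖u‖^2+‖v‖^2)/2) * Real.sinh (inner ℝ u v) := by
  have e : ∀ g : E, Real.sin (inner ℝ g u) * Real.sin (inner ℝ g v)
      = (1/2) * (Real.cos (inner ℝ g (u - v)) - Real.cos (inner ℝ g (u + v))) := by
    intro g
    rw [inner_sub_right, inner_add_right, Real.cos_sub, Real.cos_add]; ring
  simp_rw [e]
  rw [integral_const_mul, integral_sub, integral_cos_aux, integral_cos_aux, Real.sinh_eq,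
    norm_sub_sq_real, norm_add_sq_real, mul_div_assoc', mul_sub, mul_sub, ← Real.exp_add,
    ← Real.exp_add]
  · ring_nf
  · exact integrable_bdd_aux _ (by fun_prop) fun x => Real.abs_cos_le_one _
  · exact integrable_bdd_aux _ (by fun_prop) fun x => Real.abs_cos_le_one _

lemma goodMat_sinh {X Y : Type} [Fintype X] [Fintype Y] (u : X → E) (v : Y → E) :
    GoodMat (fun x y => (1 + Real.exp (-(‖u x‖^2+‖v y‖^2)/2) * Real.sinh (inner ℝ (u x) (v y)))/4) := by
  have hs : ∀ w : E, Integrable (fun g => Real.sin (inner ℝ g w)) (stdGaussian E) := fun w =>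
    integrable_bdd_aux _ (by fun_prop) fun x => Real.abs_sin_le_one _
  have hss : ∀ w w' : E, Integrable (fun g => Real.sin (inner ℝ g w) * Real.sin (inner ℝ g w'))
      (stdGaussian E) := fun w w' =>
    integrable_bdd_aux _ (by fun_prop) fun x => by
      rw [abs_mul]
      exact mul_le_one₀ (Real.abs_sin_le_one _) (abs_nonneg _) (Real.abs_sin_le_one _)
  have e : ∀ (x : X) (y : Y) (g : E), ((1 + Real.sin (inner ℝ g (u x)))/2) * ((1 + Real.sin (inner ℝ g (v y)))/2)
      = (1/4) * (1 + Real.sin (inner ℝ g (u x)) + Real.sin (inner ℝ g (v y)) +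
        Real.sin (inner ℝ g (u x)) * Real.sin (inner ℝ g (v y))) := by intros; ring
  have hint : ∀ x y, Integrable (fun g => ((1 + Real.sin (inner ℝ g (u x)))/2) * ((1 + Real.sin (inner ℝ g (v y)))/2)) (stdGaussian E) := by
    intro x y
    simp_rw [e]
    exact ((((integrable_const _).add (hs _)).add (hs _)).add (hss _ _)).const_mul _
  have key := goodMat_integral (stdGaussian E) (fun g x y =>
    ((1 + Real.sin (inner ℝ g (u x)))/2) * ((1 + Real.sin (inner ℝ g (v y)))/2)) hint
    (fun g => goodMat_rank_one (fun x => (1 + Real.sin (inner ℝ g (u x)))/2)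
      (fun y => (1 + Real.sin (inner ℝ g (v y)))/2)
      (fun i => ⟨by linarith [Real.neg_one_le_sin (inner ℝ g (u i))], by linarith [Real.sin_le_one (inner ℝ g (u i))]⟩)
      (fun i => ⟨by linarith [Real.neg_one_le_sin (inner ℝ g (v i))], by linarith [Real.sin_le_one (inner ℝ g (v i))]⟩))
  convert key using 3 with x y
  simp_rw [e]
  have h1 : Integrable (fun g : E => 1 + Real.sin (inner ℝ g (u x))) (stdGaussian E) :=
    (integrable_const _).add (hs _)
  have h2 : Integrable (fun g : E => 1 + Real.sin (inner ℝ g (u x)) + Real.sin (inner ℝ g (v y)))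
      (stdGaussian E) := h1.add (hs _)
  rw [integral_const_mul, integral_add h2 (hss _ _), integral_add h1 (hs _),
    integral_add (integrable_const _) (hs _),
    integral_sin_aux, integral_sin_aux, integral_sin_mul_sin_aux]
  simp
  ring
end gauss

section design
open Matrix
variable {X : Type} [Fintype X] {r : ℕ}

/-- The weighted Gram matrix. -/
noncomputable def gramMat (U : Matrix X (Fin r) ℝ) (p : X → ℝ) : Matrix (Fin r) (Fin r) ℝ :=
  Matrix.of fun i j => ∑ x, p x * (U x i * U x j)

lemma gramMat_form (U : Matrix X (Fin r) ℝ) (p : X → ℝ) (a b : Fin r → ℝ) :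
    ∑ x, p x * ((U x ⬝ᵥ a) * (U x ⬝ᵥ b)) = (gramMat U p *ᵥ a) ⬝ᵥ b := by
  simp only [gramMat, dotProduct, mulVec, Matrix.of_apply, Finset.sum_mul, Finset.mul_sum]
  rw [Finset.sum_comm]
  refine Finset.sum_congr rfl fun i _ => ?_
  rw [Finset.sum_comm]
  refine Finset.sum_congr rfl fun j _ => ?_
  refine Finset.sum_congr rfl fun x _ => by ring

lemma le_of_forall_pow_aux (r : ℕ) (hr : 0 < r) (s : ℝ)
    (h : ∀ τ : ℝ, 0 < τ → 1 + τ * s ≤ (1 + τ)^r) : s ≤ r := by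
  by_contra hs
  push Not at hs
  have hr' : (0:ℝ) < r := by exact_mod_cast hr
  have hs0 : 0 < s := hr'.trans hs
  set τ := (s - r) / (2 * r * s) with hτ
  have hτ0 : 0 < τ := by apply div_pos <;> [linarith; positivity]
  have hτe : τ * (2 * r * s) = s - r := by rw [hτ]; field_simp
  have h1 := h τ hτ0
  have hrt : r * τ < 1 := by
    by_contra hc
    push Not at hc
    nlinarith
  have h2 : (1 + τ)^r ≤ Real.exp (r * τ) := by
    rw [Real.exp_nat_mul]
    exact pow_le_pow_left₀ (by linarith) (by linarith [Real.add_one_le_exp τ]) _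
  have h3 : Real.exp (r * τ) * (1 - r * τ) ≤ 1 := by
    have := Real.one_sub_le_exp_neg (r * τ)
    calc _ ≤ Real.exp (r * τ) * Real.exp (-(r * τ)) := by gcongr
      _ = 1 := by rw [← Real.exp_add]; simp
  have h4 : (1 + τ * s) * (1 - r * τ) ≤ 1 :=
    le_trans (mul_le_mul_of_nonneg_right (h1.trans h2) (by linarith)) h3
  have h5 : τ * (s - r - r * s * τ) ≤ 0 := by nlinarith
  have h6 : s - r - r * s * τ ≤ 0 := by
    by_contra hc
    push Not at hc
    nlinarith
  nlinarith

lemma exists_design [Nonempty X] (hr : 0 < r) (U : Matrix X (Fin r) ℝ) (hU : U.rank = r) :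
    ∃ p : X → ℝ, (∀ x, 0 ≤ p x) ∧ ∑ x, p x = 1 ∧ IsUnit (gramMat U p).det ∧
      ∀ x, U x ⬝ᵥ ((gramMat U p)⁻¹ *ᵥ U x) ≤ r := by
  classical
  have hcont : Continuous fun p : X → ℝ => |(gramMat U p).det| := by
    refine Continuous.abs (Continuous.matrix_det ?_)
    refine continuous_matrix fun i j => ?_
    simp only [gramMat, Matrix.of_apply]
    fun_prop
  obtain ⟨p, hp, hmax⟩ := (isCompact_stdSimplex ℝ X).exists_isMaxOn
    (⟨_, single_mem_stdSimplex ℝ (Classical.arbitrary X)⟩) hcont.continuousOn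
  have hscale : ∀ (c : ℝ) (q : X → ℝ), gramMat U (fun x => c * q x) = c • gramMat U q := by
    intro c q
    ext i j
    simp [gramMat, Finset.mul_sum, mul_assoc]
  have hle : ∀ q : X → ℝ, (∀ x, 0 ≤ q x) → 0 < ∑ x, q x →
      |(gramMat U q).det| ≤ (∑ x, q x)^r * |(gramMat U p).det| := by
    intro q hq hS
    set S := ∑ x, q x
    have hm : (fun x => S⁻¹ * q x) ∈ stdSimplex ℝ X :=
      ⟨fun x => mul_nonneg (by positivity) (hq x), by
        rw [← Finset.mul_sum]; exact inv_mul_cancel₀ hS.ne'⟩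
    have := hmax hm
    simp only [Set.mem_ofPred_eq] at this
    rw [hscale, det_smul, abs_mul, Fintype.card_fin, abs_of_nonneg (by positivity), inv_pow] at this
    rwa [inv_mul_le_iff₀ (by positivity)] at this
  have hdet1 : (gramMat U (fun _ => 1)).det ≠ 0 := by
    have e : gramMat U (fun _ => 1) = Uᵀ * U := by
      ext i j
      simp [gramMat, Matrix.mul_apply]
    rw [e]
    have hrk : (Uᵀ * U).rank = r := by rw [rank_transpose_mul_self, hU]
    intro h0
    obtain ⟨w, hw0, hw⟩ := Matrix.exists_mulVec_eq_zero_iff.mpr h0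
    have := (Uᵀ * U).mulVecLin.finrank_range_add_finrank_ker
    rw [← Matrix.rank, hrk, Module.finrank_fin_fun, Nat.add_eq_left,
      Submodule.finrank_eq_zero] at this
    exact hw0 ((LinearMap.ker_eq_bot'.mp this) w hw)
  have hD : 0 < |(gramMat U p).det| := by
    have h1 := hle (fun _ => 1) (fun _ => zero_le_one) (by simp [Fintype.card_pos])
    by_contra hc
    have h0 : |(gramMat U p).det| = 0 := le_antisymm (not_lt.mp hc) (abs_nonneg _)
    rw [h0, mul_zero] at h1
    exact hdet1 (abs_eq_zero.mp (le_antisymm h1 (abs_nonneg _)))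
  have hunit : IsUnit (gramMat U p).det := isUnit_iff_ne_zero.mpr (abs_pos.mp hD)
  refine ⟨p, hp.1, hp.2, hunit, fun x => le_of_forall_pow_aux r hr _ fun τ hτ => ?_⟩
  have h1 := hle (fun x' => p x' + τ * (if x' = x then 1 else 0))
    (fun x' => add_nonneg (hp.1 x') (by positivity)) (by
      rw [Finset.sum_add_distrib, hp.2, ← Finset.mul_sum]; simp; linarith)
  have hsum : ∑ x', (p x' + τ * (if x' = x then 1 else 0)) = 1 + τ := by
    rw [Finset.sum_add_distrib, hp.2, ← Finset.mul_sum]; simp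
  have hg : gramMat U (fun x' => p x' + τ * (if x' = x then 1 else 0))
      = gramMat U p + replicateCol Unit (τ • U x) * replicateRow Unit (U x) := by
    ext i j
    simp [gramMat, Matrix.mul_apply, add_mul, Finset.sum_add_distrib]
  rw [hsum, hg, det_add_replicateCol_mul_replicateRow hunit, abs_mul, mul_comm] at h1
  have h2 := le_of_mul_le_mul_right h1 hD
  refine le_trans (le_trans (le_of_eq ?_) (le_abs_self _)) h2
  rw [det_unique, Matrix.mul_assoc, ← Matrix.replicateCol_mulVec]
  simp [Matrix.mulVec_smul]

lemma exists_factor {Y : Type} [Fintype Y] (f : Matrix X Y ℝ) (hf : f.rank = r) :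
    ∃ (U : Matrix X (Fin r) ℝ) (V : Matrix (Fin r) Y ℝ), f = U * V ∧ U.rank = r := by
  set S := Submodule.span ℝ (Set.range f.row) with hS
  have hfin : Module.finrank ℝ S = r := by rw [← hf, rank_eq_finrank_span_row]
  let b := Module.finBasisOfFinrankEq ℝ S hfin
  have hmem : ∀ x, f.row x ∈ S := fun x => Submodule.subset_span ⟨x, rfl⟩
  let U : Matrix X (Fin r) ℝ := Matrix.of fun x j => b.repr ⟨f.row x, hmem x⟩ j
  let V : Matrix (Fin r) Y ℝ := Matrix.of fun j y => (b j : Y → ℝ) y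
  have hUV : f = U * V := by
    ext x y
    have := b.sum_repr ⟨f.row x, hmem x⟩
    have h2 := congrArg (fun z : S => (z : Y → ℝ) y) this
    simp only [Submodule.coe_sum, Submodule.coe_smul, Finset.sum_apply, Pi.smul_apply,
      smul_eq_mul] at h2
    exact h2.symm
  refine ⟨U, V, hUV, le_antisymm ?_ ?_⟩
  · simpa using rank_le_card_width U
  · have h := rank_mul_le_left U V
    rw [← hUV] at h
    exact hf.symm.le.trans h

lemma exists_vectors {Y : Type} [Fintype Y] [Nonempty X] (hr : 0 < r) (f : Matrix X Y ℝ)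
    (hf : f.rank = r) (hb : ∀ x y, f x y ^ 2 ≤ 1) :
    ∃ (u : X → EuclideanSpace ℝ X) (v : Y → EuclideanSpace ℝ X),
      (∀ x, ‖u x‖^2 ≤ r) ∧ (∀ y, ‖v y‖^2 ≤ 1) ∧ ∀ x y, inner ℝ (u x) (v y) = f x y := by
  obtain ⟨U, V, hUV, hU⟩ := exists_factor f hf
  obtain ⟨p, hp0, hp1, hunit, hle⟩ := exists_design hr U hU
  have hfU : ∀ x y, U x ⬝ᵥ (fun j => V j y) = f x y := by
    intro x y
    rw [hUV]; rfl
  have hinv : ∀ x, gramMat U p *ᵥ ((gramMat U p)⁻¹ *ᵥ U x) = U x := by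
    intro x
    rw [mulVec_mulVec, Matrix.mul_nonsing_inv _ hunit, one_mulVec]
  refine ⟨fun x => WithLp.toLp 2 fun x' => √(p x') * (U x' ⬝ᵥ ((gramMat U p)⁻¹ *ᵥ U x)),
    fun y => WithLp.toLp 2 fun x' => √(p x') * f x' y, fun x => ?_, fun y => ?_, fun x y => ?_⟩
  · rw [EuclideanSpace.real_norm_sq_eq]
    have : ∀ x', (√(p x') * (U x' ⬝ᵥ ((gramMat U p)⁻¹ *ᵥ U x)))^2 = p x' *
      ((U x' ⬝ᵥ ((gramMat U p)⁻¹ *ᵥ U x)) * (U x' ⬝ᵥ ((gramMat U p)⁻¹ *ᵥ U x))) := by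
      intro x'
      rw [mul_pow, Real.sq_sqrt (hp0 x'), sq]
    simp only [this]
    rw [gramMat_form, hinv]
    exact hle x
  · rw [EuclideanSpace.real_norm_sq_eq, ← hp1]
    refine Finset.sum_le_sum fun x' _ => ?_
    simp only [mul_pow, Real.sq_sqrt (hp0 x')]
    nlinarith [hb x' y, hp0 x']
  · rw [PiLp.inner_apply]
    have : ∀ x', inner ℝ (√(p x') * (U x' ⬝ᵥ ((gramMat U p)⁻¹ *ᵥ U x))) (√(p x') * f x' y) = p x' *
      ((U x' ⬝ᵥ ((gramMat U p)⁻¹ *ᵥ U x)) * (U x' ⬝ᵥ (fun j => V j y))) := by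
      intro x'
      rw [hfU]
      simp only [RCLike.inner_apply, conj_trivial]
      nth_rewrite 3 [← Real.mul_self_sqrt (hp0 x')]
      ring
    simp only [this]
    rw [gramMat_form, hinv, hfU]
end design

lemma exists_mono_of_small_error {X Y : Type} [Fintype X] [Fintype Y] {r : ℕ} (hr : 0 < r)
    (f : Matrix X Y ℝ) (hf : f.rank = r) (hpm : ∀ x y, f x y = 1 ∨ f x y = -1)
    (A : Finset X) (B : Finset Y)
    (hsmall : (8 * r : ℝ) * ∑ x ∈ A, (#{y ∈ B | f x y = -1} : ℝ) ≤ #A * #B) :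
    ∃ (A' : Finset X) (B' : Finset Y), (∀ x ∈ A', ∀ y ∈ B', f x y = 1) ∧
      (#A * #B : ℝ) ≤ 4 * (#A' * #B') := by
  classical
  rcases B.eq_empty_or_nonempty with rfl | hB
  · exact ⟨∅, ∅, by simp, by simp⟩
  have hBpos : (0:ℝ) < #B := by exact_mod_cast hB.card_pos
  have hr' : (1:ℝ) ≤ r := by exact_mod_cast hr
  set z : X → ℝ := fun x => (#{y ∈ B | f x y = -1} : ℝ) with hz
  have hz0 : ∀ x, 0 ≤ z x := fun x => by positivity
  set A' := {x ∈ A | 4 * r * z x ≤ #B} with hA'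
  have hA'card : (#A : ℝ) ≤ 2 * #A' := by
    have h1 : (∑ x ∈ A, if 4 * r * z x ≤ #B then (0:ℝ) else #B) ≤ ∑ x ∈ A, 4 * r * z x := by
      refine Finset.sum_le_sum fun x _ => ?_
      split_ifs with h
      · have := hz0 x; positivity
      · exact (not_le.mp h).le
    rw [← Finset.mul_sum] at h1
    have h2 : (∑ x ∈ A, if 4 * r * z x ≤ #B then (0:ℝ) else #B)
        = ((#A : ℝ) - #A') * #B := by
      have hc := Finset.card_filter_add_card_filter_not (s := A) (fun x => 4 * r * z x ≤ #B)
      have hc' : (#A : ℝ) - #A' = (#{x ∈ A | ¬ 4 * r * z x ≤ #B} : ℝ) := by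
        rw [← hc, hA']; push_cast; ring
      rw [hc', Finset.sum_ite]
      simp
    rw [h2] at h1
    have h3 : ((#A : ℝ) - #A') * #B ≤ (#A / 2) * #B := by linarith
    linarith [le_of_mul_le_mul_right h3 hBpos]
  obtain ⟨b, hbs, hspan, hli⟩ := exists_linearIndependent ℝ (f.row '' (A' : Set X))
  have hbfin : b.Finite := (Set.toFinite _).subset hbs
  lift b to Finset (Y → ℝ) using hbfin
  have hbcard : #b ≤ r := by
    have h1 := finrank_span_finset_eq_card hli
    rw [← h1, ← hf, Matrix.rank_eq_finrank_span_row]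
    exact Submodule.finrank_mono (Submodule.span_mono (hbs.trans (Set.image_subset_range _ _)))
  set B' := {y ∈ B | ∀ w ∈ b, w y = 1} with hB'
  have hconst : ∀ x ∈ A', ∀ y ∈ B', ∀ y' ∈ B', f x y = f x y' := by
    intro x hx y hy y' hy'
    have hmem : f.row x ∈ Submodule.span ℝ (b : Set (Y → ℝ)) := by
      rw [hspan]; exact Submodule.subset_span ⟨x, hx, rfl⟩
    have hsub : Submodule.span ℝ (b : Set (Y → ℝ)) ≤
        LinearMap.ker ((LinearMap.proj y : (Y → ℝ) →ₗ[ℝ] ℝ) - LinearMap.proj y') := by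
      rw [Submodule.span_le]
      intro w hw
      simp only [hB', Finset.mem_filter] at hy hy'
      simp [hy.2 w hw, hy'.2 w hw]
    have := hsub hmem
    simpa [sub_eq_zero, Matrix.row] using this
  have hB'card : 3 * (#B : ℝ) ≤ 4 * #B' := by
    have hc := Finset.card_filter_add_card_filter_not (s := B) (fun y => ∀ w ∈ b, w y = 1)
    have hsubset : {y ∈ B | ¬ ∀ w ∈ b, w y = 1} ⊆ b.biUnion fun w => {y ∈ B | w y ≠ 1} := by
      intro y hy
      simp only [Finset.mem_filter, Finset.mem_biUnion] at hy ⊢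
      obtain ⟨h1, h2⟩ := hy
      push Not at h2
      obtain ⟨w, hw, hwy⟩ := h2
      exact ⟨w, hw, h1, hwy⟩
    have h1 : (#{y ∈ B | ¬ ∀ w ∈ b, w y = 1} : ℝ) ≤ ∑ w ∈ b, (#{y ∈ B | w y ≠ 1} : ℝ) := by
      exact_mod_cast (Finset.card_le_card hsubset).trans Finset.card_biUnion_le
    have h2 : ∀ w ∈ b, (#{y ∈ B | w y ≠ 1} : ℝ) ≤ #B / (4 * r) := by
      intro w hw
      obtain ⟨x, hx, rfl⟩ := hbs hw
      have hx' : x ∈ A' := hx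
      simp only [hA', Finset.mem_filter] at hx'
      rw [le_div_iff₀ (by positivity), mul_comm]
      refine le_trans (le_of_eq ?_) hx'.2
      simp only [hz]
      congr 3
      refine Finset.filter_congr fun y _ => ?_
      simp only [Matrix.row]
      rcases hpm x y with h | h <;> norm_num [h]
    have h3 : ∑ w ∈ b, (#{y ∈ B | w y ≠ 1} : ℝ) ≤ #B / 4 := by
      refine (Finset.sum_le_card_nsmul _ _ _ h2).trans ?_
      rw [nsmul_eq_mul]
      calc (#b : ℝ) * (#B / (4 * r)) ≤ r * (#B / (4 * r)) := by gcongr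
        _ = #B / 4 := by field_simp
    have hc' : (#B : ℝ) = #B' + (#{y ∈ B | ¬ ∀ w ∈ b, w y = 1} : ℝ) := by
      rw [← hc]; push_cast; rfl
    linarith
  refine ⟨A', B', ?_, by nlinarith⟩
  intro x hx y hy
  rcases hpm x y with h | h
  · exact h
  · exfalso
    have hs : B' ⊆ {y ∈ B | f x y = -1} := by
      intro y' hy'
      rw [Finset.mem_filter]
      exact ⟨(Finset.mem_filter.mp hy').1, by rw [hconst x hx y' hy' y hy, h]⟩
    have h1 : (#B' : ℝ) ≤ z x := Nat.cast_le.mpr (Finset.card_le_card hs)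
    have h2 := (Finset.mem_filter.mp hx).2
    nlinarith [hz0 x]

set_option maxHeartbeats 1600000 in
lemma core_rect {X Y : Type} [Fintype X] [Fintype Y] [Nonempty X] {r : ℕ} (hr : 0 < r)
    (f : Matrix X Y ℝ) (hf : f.rank = r) (hpm : ∀ x y, f x y = 1 ∨ f x y = -1)
    (hmaj : (Fintype.card X * Fintype.card Y : ℝ) ≤ 2 * ∑ x, ∑ y, if f x y = 1 then (1:ℝ) else 0)
    (k : ℕ) (hk : Real.exp 1 * √r * Real.log (16 * r) ≤ k) :
    ∃ (A : Finset X) (B : Finset Y), (∀ x ∈ A, ∀ y ∈ B, f x y = 1) ∧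
      (Fintype.card X * Fintype.card Y : ℝ) ≤ 4 ^ (k + 2) * (#A * #B) := by
  classical
  have hr1 : (1:ℝ) ≤ r := by exact_mod_cast hr
  have hsq : 0 < √(r:ℝ) := Real.sqrt_pos.mpr (by linarith)
  have hsqr : √(r:ℝ)^2 = r := Real.sq_sqrt (by linarith)
  obtain ⟨u, v, hu, hv, huv⟩ := exists_vectors hr f hf
    (fun x y => by rcases hpm x y with h | h <;> norm_num [h])
  have hG := goodMat_pow (goodMat_sinh (fun x => (√(r:ℝ))⁻¹ • u x) v) k
  set κ : X → Y → ℝ := fun x y => Real.exp (-(‖(√(r:ℝ))⁻¹ • u x‖^2+‖v y‖^2)/2) *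
    Real.sinh (inner ℝ ((√(r:ℝ))⁻¹ • u x) (v y)) with hκ
  set δ : ℝ := Real.exp (-1) * (√(r:ℝ))⁻¹ with hδ
  have hδ0 : 0 < δ := by positivity
  have hin : ∀ x y, inner ℝ ((√(r:ℝ))⁻¹ • u x) (v y) = (√(r:ℝ))⁻¹ * f x y := by
    intro x y
    rw [real_inner_smul_left, huv]
  have hnu : ∀ x, ‖(√(r:ℝ))⁻¹ • u x‖^2 ≤ 1 := by
    intro x
    rw [norm_smul, mul_pow, Real.norm_eq_abs, sq_abs, inv_pow, hsqr,
      inv_mul_le_iff₀ (by linarith), mul_one]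
    exact hu x
  have hexp : ∀ x y, Real.exp (-1) ≤ Real.exp (-(‖(√(r:ℝ))⁻¹ • u x‖^2+‖v y‖^2)/2) := by
    intro x y
    apply Real.exp_le_exp.mpr
    linarith [hnu x, hv y]
  have hsinh : (√(r:ℝ))⁻¹ ≤ Real.sinh (√(r:ℝ))⁻¹ := Real.self_le_sinh_iff.mpr (by positivity)
  have hprod : ∀ x y, δ ≤ Real.exp (-(‖(√(r:ℝ))⁻¹ • u x‖^2+‖v y‖^2)/2) *
      Real.sinh (√(r:ℝ))⁻¹ := fun x y =>
    mul_le_mul (hexp x y) hsinh (by positivity) (Real.exp_pos _).le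
  have hκ1 : ∀ x y, f x y = 1 → 0 ≤ κ x y := by
    intro x y h
    simp only [hκ]
    rw [hin, h, mul_one]
    exact hδ0.le.trans (hprod x y)
  have hκ2 : ∀ x y, f x y = -1 → κ x y ≤ -δ := by
    intro x y h
    simp only [hκ]
    rw [hin, h, mul_neg_one, Real.sinh_neg, mul_neg]
    linarith [hprod x y]
  have hκ3 : ∀ x y, f x y = -1 → -1 ≤ κ x y := by
    intro x y h
    simp only [hκ]
    have h1 := neg_le_of_abs_le (abs_real_inner_le_norm ((√(r:ℝ))⁻¹ • u x) (v y))
    set a := (√(r:ℝ))⁻¹ • u x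
    set t := inner ℝ a (v y)
    have h2 : -t ≤ (‖a‖^2+‖v y‖^2)/2 := by nlinarith [sq_nonneg (‖a‖ - ‖v y‖)]
    have h3 : -Real.exp (-t) ≤ Real.sinh t := by
      rw [Real.sinh_eq]; linarith [Real.exp_pos t, Real.exp_pos (-t)]
    have h4 : Real.exp (-(‖a‖^2+‖v y‖^2)/2) * Real.exp (-t) ≤ 1 := by
      rw [← Real.exp_add, Real.exp_le_one_iff]; linarith
    nlinarith [Real.exp_pos (-(‖a‖^2+‖v y‖^2)/2)]
  have hLk : 8 * r * (1 - δ)^k ≤ 1/2 ∧ 0 ≤ 1 - δ := by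
    have hδ1 : δ ≤ 1 := by
      have h1 : Real.exp (-1) ≤ 1 := Real.exp_le_one_iff.mpr (by norm_num)
      have h2 : (√(r:ℝ))⁻¹ ≤ 1 := inv_le_one_of_one_le₀ (Real.one_le_sqrt.mpr hr1)
      exact mul_le_one₀ h1 (by positivity) h2
    refine ⟨?_, by linarith⟩
    have h1 : (1 - δ)^k ≤ Real.exp (-(k * δ)) := by
      rw [← mul_neg, Real.exp_nat_mul]
      exact pow_le_pow_left₀ (by linarith) (Real.one_sub_le_exp_neg δ) _
    have h2 : Real.log (16 * r) ≤ k * δ := by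
      have := mul_le_mul_of_nonneg_right hk hδ0.le
      refine le_trans (le_of_eq ?_) this
      rw [hδ, Real.exp_neg]
      field_simp
    have h3 : Real.exp (-(k * δ)) ≤ (16 * r : ℝ)⁻¹ := by
      rw [← Real.exp_log (by positivity : (0:ℝ) < 16 * r), ← Real.exp_neg]
      exact Real.exp_le_exp.mpr (by linarith)
    calc 8 * r * (1 - δ)^k ≤ 8 * r * (16 * r : ℝ)⁻¹ := by gcongr; exact h1.trans h3
      _ = 1/2 := by field_simp; norm_num
  obtain ⟨A, B, hAB⟩ := hG (fun x y => if f x y = 1 then 1 else -(8 * r))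
  set N : ℝ := ∑ x, ∑ y, if f x y = 1 then (1:ℝ) else 0 with hN
  set Z : ℝ := ∑ x, ∑ y, if f x y = 1 then (0:ℝ) else 1 with hZ
  have hNZ : N + Z = Fintype.card X * Fintype.card Y := by
    rw [hN, hZ, ← Finset.sum_add_distrib]
    simp_rw [← Finset.sum_add_distrib]
    have : ∀ x y, ((if f x y = 1 then (1:ℝ) else 0) + (if f x y = 1 then (0:ℝ) else 1)) = 1 := by
      intro x y; split_ifs <;> norm_num
    simp [this]
  have hlow : (1/4:ℝ)^k * (N - Z / 2) ≤ ∑ x, ∑ y, (if f x y = 1 then (1:ℝ) else -(8 * r)) *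
      ((1 + κ x y)/4)^k := by
    have e : (1/4:ℝ)^k * (N - Z / 2) = ∑ x, ∑ y, (if f x y = 1 then (1/4:ℝ)^k else -((1/4)^k/2)) := by
      rw [hN, hZ, Finset.sum_div, ← Finset.sum_sub_distrib, Finset.mul_sum]
      refine Finset.sum_congr rfl fun x _ => ?_
      rw [Finset.sum_div, ← Finset.sum_sub_distrib, Finset.mul_sum]
      refine Finset.sum_congr rfl fun y _ => ?_
      split_ifs <;> ring
    rw [e]
    refine Finset.sum_le_sum fun x _ => Finset.sum_le_sum fun y _ => ?_
    split_ifs with h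
    · rw [one_mul]
      exact pow_le_pow_left₀ (by norm_num) (by linarith [hκ1 x y h]) _
    · have h' := (hpm x y).resolve_left h
      have h1 : ((1 + κ x y)/4)^k ≤ ((1 - δ) * (1/4))^k :=
        pow_le_pow_left₀ (by linarith [hκ3 x y h']) (by linarith [hκ2 x y h']) _
      rw [mul_pow] at h1
      have h2 : 8 * r * ((1 + κ x y)/4)^k ≤ (1/2) * (1/4)^k := by
        calc 8 * r * ((1 + κ x y)/4)^k ≤ 8 * r * ((1 - δ)^k * (1/4)^k) := by gcongr
          _ = (8 * r * (1 - δ)^k) * (1/4)^k := by ring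
          _ ≤ _ := by gcongr; exact hLk.1
      linarith
  have hZN : Z ≤ N := by linarith
  have hN0 : (Fintype.card X * Fintype.card Y : ℝ) / 4 ≤ N - Z/2 := by linarith
  set n1 : ℝ := ∑ x ∈ A, (#{y ∈ B | f x y = 1} : ℝ) with hn1
  set n0 : ℝ := ∑ x ∈ A, (#{y ∈ B | f x y = -1} : ℝ) with hn0
  have hrow : ∀ x, (#{y ∈ B | f x y = 1} : ℝ) + (#{y ∈ B | f x y = -1} : ℝ) = #B := by
    intro x
    have hc := Finset.card_filter_add_card_filter_not (s := B) (fun y => f x y = 1)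
    have : {y ∈ B | ¬ f x y = 1} = {y ∈ B | f x y = -1} := by
      refine Finset.filter_congr fun y _ => ?_
      rcases hpm x y with h | h <;> norm_num [h]
    rw [this] at hc
    exact_mod_cast hc
  have hsum : n1 + n0 = #A * #B := by
    rw [hn1, hn0, ← Finset.sum_add_distrib]
    simp [hrow]
  have hval : ∑ x ∈ A, ∑ y ∈ B, (if f x y = 1 then (1:ℝ) else -(8 * r)) = n1 - 8 * r * n0 := by
    rw [hn1, hn0, Finset.mul_sum, ← Finset.sum_sub_distrib]
    refine Finset.sum_congr rfl fun x _ => ?_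
    have : {y ∈ B | f x y = -1} = {y ∈ B | ¬ f x y = 1} := by
      refine Finset.filter_congr fun y _ => ?_
      rcases hpm x y with h | h <;> norm_num [h]
    rw [Finset.sum_ite, this]
    simp
    ring
  have hn00 : 0 ≤ n0 := Finset.sum_nonneg fun _ _ => by positivity
  clear_value n0 n1 N Z
  rw [hval] at hAB
  have hfin := hlow.trans hAB
  have hcc : (0:ℝ) ≤ (Fintype.card X * Fintype.card Y : ℝ) := by positivity
  have h4 : (1/4:ℝ)^k * ((Fintype.card X * Fintype.card Y : ℝ) / 4) ≤ n1 - 8 * r * n0 :=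
    le_trans (by gcongr) hfin
  have h5 : 0 ≤ n1 - 8 * r * n0 := le_trans (by positivity) h4
  obtain ⟨A', B', hm, hc⟩ := exists_mono_of_small_error hr f hf hpm A B
    (by rw [← hn0]; linarith)
  refine ⟨A', B', hm, ?_⟩
  have h6 : (1/4:ℝ)^k * ((Fintype.card X * Fintype.card Y : ℝ) / 4) ≤ 4 * (#A' * #B') := by
    have : 0 ≤ 8 * r * n0 := mul_nonneg (mul_nonneg (by norm_num) (Nat.cast_nonneg r)) hn00
    linarith
  have h7 : (4:ℝ)^k * (1/4)^k = 1 := by rw [← mul_pow]; norm_num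
  have h8 := mul_le_mul_of_nonneg_left h6 (by positivity : (0:ℝ) ≤ 4^k)
  rw [← mul_assoc, h7] at h8
  rw [pow_add]
  linarith

lemma final_bound {r : ℕ} (hr : 2 ≤ r) (n m : ℝ)
    (h : n ≤ 4 ^ (⌈Real.exp 1 * √r * Real.log (16 * r)⌉₊ + 2) * m) (hm : 0 ≤ m) :
    m ≥ 2 ^ (-(40 * Real.sqrt r * Real.log r)) * n := by
  have hr2 : (2:ℝ) ≤ r := by exact_mod_cast hr
  set k := ⌈Real.exp 1 * √r * Real.log (16 * r)⌉₊ with hk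
  have hlog2 := Real.log_two_gt_d9
  have hlogr : Real.log 2 ≤ Real.log r := Real.log_le_log (by norm_num) hr2
  have h16 : Real.log (16 * r) ≤ 5 * Real.log r := by
    rw [Real.log_mul (by norm_num) (by linarith), show (16:ℝ) = 2^4 by norm_num, Real.log_pow]
    push_cast; linarith
  have hsq : (1.4:ℝ) ≤ √r := Real.le_sqrt_of_sq_le (by norm_num; linarith)
  have hlog16 : 0 ≤ Real.log (16 * r) := Real.log_nonneg (by linarith)
  have hkle : (k:ℝ) < Real.exp 1 * √r * Real.log (16 * r) + 1 :=
    Nat.ceil_lt_add_one (by positivity)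
  have he : Real.exp 1 ≤ 3 := by linarith [Real.exp_one_lt_d9]
  have hk2 : Real.exp 1 * √r * Real.log (16 * r) ≤ 3 * √r * (5 * Real.log r) := by gcongr
  have hlow : (0.9:ℝ) ≤ √r * Real.log r := by nlinarith
  have hk3 : ((k + 2 : ℕ) : ℝ) * 2 ≤ 40 * √r * Real.log r := by push_cast; nlinarith
  have hpow : (4:ℝ)^(k+2) ≤ 2 ^ (40 * √r * Real.log r) := by
    calc (4:ℝ)^(k+2) = 2 ^ (((k + 2 : ℕ) : ℝ) * 2) := by
          rw [show (4:ℝ) = 2^2 by norm_num, ← pow_mul, ← Real.rpow_natCast]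
          push_cast; ring_nf
      _ ≤ _ := Real.rpow_le_rpow_of_exponent_le (by norm_num) hk3
  rw [Real.rpow_neg (by norm_num), ge_iff_le, inv_mul_le_iff₀ (by positivity)]
  exact h.trans (by gcongr)

/-- there is an absolute constant `C > 0` such that every boolean function
of rank `r ≥ 2` on finite nonempty sets has a monochromatic rectangle of size at least
`2^(-C·√r·log r)·|X × Y|`. -/
theorem exists_large_monochromatic_rectangle :
    ∃ C : ℝ, 0 < C ∧
      ∀ (X Y : Type) [Fintype X] [Fintype Y] [Nonempty X] [Nonempty Y]
        (f : X × Y → ℝ), (∀ p, f p = 1 ∨ f p = -1) →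
        ∀ r : ℕ, (Matrix.of fun x y => f (x, y)).rank = r → 2 ≤ r →
          ∃ (A : Finset X) (B : Finset Y),
            (∀ p q : X × Y, p.1 ∈ A → p.2 ∈ B → q.1 ∈ A → q.2 ∈ B → f p = f q) ∧
            ((A.card * B.card : ℕ) : ℝ) ≥
              2 ^ (-(C * Real.sqrt r * Real.log r)) *
                (Fintype.card X * Fintype.card Y : ℕ) := by
  refine ⟨40, by norm_num, ?_⟩
  intro X Y _ _ _ _ f hf r hr hr2
  classical
  have hr0 : 0 < r := by omega
  set F : Matrix X Y ℝ := Matrix.of fun x y => f (x, y) with hF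
  have hFpm : ∀ x y, F x y = 1 ∨ F x y = -1 := fun x y => hf (x, y)
  have hrneg : (-F).rank = r := by
    have e : (-F).mulVecLin = -F.mulVecLin := by
      ext1 w
      simp [Matrix.neg_mulVec]
    rw [← hr, Matrix.rank, Matrix.rank, e, LinearMap.range_neg]
  have hnegpm : ∀ x y, (-F) x y = 1 ∨ (-F) x y = -1 := by
    intro x y
    rcases hFpm x y with h | h
    · right; simp [h]
    · left; simp [h]
  have htot : (Fintype.card X * Fintype.card Y : ℝ) =
      (∑ x, ∑ y, if F x y = 1 then (1:ℝ) else 0) + ∑ x, ∑ y, if (-F) x y = 1 then (1:ℝ) else 0 := by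
    rw [← Finset.sum_add_distrib]
    simp_rw [← Finset.sum_add_distrib]
    have : ∀ x y, ((if F x y = 1 then (1:ℝ) else 0) + (if (-F) x y = 1 then (1:ℝ) else 0)) = 1 := by
      intro x y
      rcases hFpm x y with h | h <;> norm_num [h]
    simp only [this]
    simp
  rcases le_total (∑ x, ∑ y, if (-F) x y = 1 then (1:ℝ) else 0)
    (∑ x, ∑ y, if F x y = 1 then (1:ℝ) else 0) with hle | hle
  · obtain ⟨A, B, hm, hc⟩ := core_rect hr0 F hr hFpm (by linarith) _ (Nat.le_ceil _)
    refine ⟨A, B, ?_, ?_⟩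
    · intro p q h1 h2 h3 h4
      exact (hm p.1 h1 p.2 h2).trans (hm q.1 h3 q.2 h4).symm
    · push_cast
      exact final_bound hr2 _ _ hc (by positivity)
  · obtain ⟨A, B, hm, hc⟩ := core_rect hr0 (-F) hrneg hnegpm (by linarith) _ (Nat.le_ceil _)
    refine ⟨A, B, ?_, ?_⟩
    · intro p q h1 h2 h3 h4
      have := (hm p.1 h1 p.2 h2).trans (hm q.1 h3 q.2 h4).symm
      exact neg_injective this
    · push_cast
      exact final_bound hr2 _ _ hc (by positivity)
end

section
/- Let f : X × Y → {-1,1} be a boolean function on finite sets with disc(f) = δ, and let σ be a probability distribution on X × Y with E_σ[f] = Σ_{(x,y)} σ(x,y)·f(x,y) = 0. Then there exists a rectangle R = A × B such that Σ_{(x,y)∈R} σ(x,y)·f(x,y) ≥ δ/3. -/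
open Finset

/-- if `disc f = δ` and `σ` is a distribution with `E_σ[f] = 0`, then
some rectangle has (signed) bias at least `δ/3` under `σ`. -/
theorem exists_rectangle_bias_of_balanced
    {X Y : Type} [Fintype X] [Fintype Y]
    (f : X × Y → ℝ) (hf : ∀ p, f p = 1 ∨ f p = -1)
    (δ : ℝ) (hδ : disc f = δ)
    (σ : X × Y → ℝ) (hσ0 : ∀ p, 0 ≤ σ p) (hσ1 : ∑ p, σ p = 1)
    (hbal : ∑ p, σ p * f p = 0) :
    ∃ (A : Finset X) (B : Finset Y),
      (∑ x ∈ A, ∑ y ∈ B, σ (x, y) * f (x, y)) ≥ δ / 3 := by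
  classical
  have h1 : disc f ≤ discMu f σ := by
    apply csInf_le
    · refine ⟨0, ?_⟩
      rintro d ⟨μ, -, -, rfl⟩
      apply Real.sSup_nonneg
      rintro d ⟨A, B, rfl⟩
      exact abs_nonneg _
    · exact ⟨σ, hσ0, hσ1, rfl⟩
  have h2 : discMu f σ ∈ { d : ℝ | ∃ (A : Finset X) (B : Finset Y),
      d = |∑ x ∈ A, ∑ y ∈ B, σ (x, y) * f (x, y)| } := by
    apply Set.Nonempty.csSup_mem
    · exact ⟨_, ∅, ∅, rfl⟩
    · apply (Set.finite_range (fun q : Finset X × Finset Y =>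
        |∑ x ∈ q.1, ∑ y ∈ q.2, σ (x, y) * f (x, y)|)).subset
      rintro d ⟨A, B, rfl⟩
      exact ⟨(A, B), rfl⟩
  obtain ⟨A, B, hAB⟩ := h2
  rw [hδ, hAB] at h1
  have hsplit : ∀ x, ∑ y, σ (x, y) * f (x, y)
      = ∑ y ∈ B, σ (x, y) * f (x, y) + ∑ y ∈ Bᶜ, σ (x, y) * f (x, y) :=
    fun x => (Finset.sum_add_sum_compl B _).symm
  rw [Fintype.sum_prod_type, ← Finset.sum_add_sum_compl A] at hbal
  simp only [hsplit, Finset.sum_add_distrib] at hbal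
  by_contra! hcon
  have e0 := hcon ∅ ∅
  have e1 := hcon A B
  have e2 := hcon A Bᶜ
  have e3 := hcon Aᶜ B
  have e4 := hcon Aᶜ Bᶜ
  simp only [Finset.sum_empty] at e0
  rcases le_abs.mp h1 with h | h <;> linarith
end

section
/- Let f : X × Y → {-1,1} be a boolean function on finite sets with disc(f) = δ, and assume f attains both values 1 and -1. Then there exists a finitely supported probability distribution ρ on the set of rectangles of X × Y such that for every (x₁,y₁) with f(x₁,y₁) = 1 and every (x₂,y₂) with f(x₂,y₂) = -1 one has Pr_{R∼ρ}[(x₁,y₁) ∈ R] − Pr_{R∼ρ}[(x₂,y₂) ∈ R] ≥ (2/3)·δ. -/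
open Finset

/-- Finite minimax (one direction), from Hahn-Banach. -/
theorem minimax_aux {I J : Type} [Fintype I] [Fintype J] [Nonempty J]
    (M : I → J → ℝ) (c : ℝ)
    (h : ∀ ν : J → ℝ, (∀ j, 0 ≤ ν j) → ∑ j, ν j = 1 → ∃ i, c ≤ ∑ j, ν j * M i j) :
    ∃ ρ : I → ℝ, (∀ i, 0 ≤ ρ i) ∧ ∑ i, ρ i = 1 ∧ ∀ j, c ≤ ∑ i, ρ i * M i j := by
  classical
  by_contra hcon
  push Not at hcon
  have hSc : IsCompact ((fun ρ : I → ℝ => fun j => ∑ i, ρ i * M i j) '' stdSimplex ℝ I) := by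
    apply (isCompact_stdSimplex ℝ I).image
    fun_prop
  have hSx : Convex ℝ ((fun ρ : I → ℝ => fun j => ∑ i, ρ i * M i j) '' stdSimplex ℝ I) := by
    apply (convex_stdSimplex ℝ I).is_linear_image
    constructor
    · intro a b; ext j; simp [add_mul, Finset.sum_add_distrib]
    · intro a b; ext j; simp [mul_assoc, Finset.mul_sum]
  have hdis : Disjoint ((fun ρ : I → ℝ => fun j => ∑ i, ρ i * M i j) '' stdSimplex ℝ I)
      (Set.Ici (fun _ : J => c)) := by
    rw [Set.disjoint_left]
    rintro _ ⟨ρ, ⟨h0, h1⟩, rfl⟩ hle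
    obtain ⟨j, hj⟩ := hcon ρ h0 h1
    exact absurd (hle j) (not_le.2 hj)
  obtain ⟨g, u, v, hu, huv, hv⟩ :=
    geometric_hahn_banach_compact_closed hSx hSc (convex_Ici _) isClosed_Ici hdis
  have hg : ∀ w : J → ℝ, g w = ∑ j, w j * g (Pi.single j 1) := by
    intro w
    conv_lhs => rw [pi_eq_sum_univ' w]
    simp [map_sum]
  have hpos : ∀ j, 0 ≤ g (Pi.single j 1) := by
    intro j
    by_contra hneg
    push Not at hneg
    have hc := hv (fun _ => c) (Set.mem_Ici.2 le_rfl)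
    set a := g (Pi.single j 1)
    have ht : 0 ≤ (g (fun _ => c) - v) / (-a) := div_nonneg (by linarith) (by linarith)
    have := hv ((fun _ => c) + ((g (fun _ => c) - v) / (-a)) • (Pi.single j 1 : J → ℝ)) (by
      rw [Set.mem_Ici]
      intro k
      have : (0:ℝ) ≤ (Pi.single j 1 : J → ℝ) k := by
        by_cases hk : k = j
        · subst hk; simp
        · simp [hk]
      simp only [Pi.add_apply, Pi.smul_apply, smul_eq_mul]
      nlinarith [mul_nonneg ht this])
    rw [map_add, map_smul, smul_eq_mul] at this
    have h3 : (g (fun _ => c) - v) / (-a) * a = -(g (fun _ => c) - v) := by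
      rw [div_neg, neg_mul, div_mul_cancel₀ _ hneg.ne]
    change v < _ + (g (fun _ => c) - v) / (-a) * a at this
    rw [h3] at this
    linarith
  have hc := hv (fun _ => c) (Set.mem_Ici.2 le_rfl)
  rw [hg, ← Finset.mul_sum] at hc
  have hrow : ∀ i, ∑ j, M i j * g (Pi.single j 1) < u := by
    intro i
    rw [← hg]
    apply hu
    refine ⟨Pi.single i 1, single_mem_stdSimplex ℝ i, ?_⟩
    ext j
    simp [Pi.single_apply]
  have hs0 : 0 ≤ ∑ j, g (Pi.single j 1) := Finset.sum_nonneg (fun j _ => hpos j)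
  have hI : Nonempty I := by
    obtain ⟨i, -⟩ := h (Pi.single (Classical.arbitrary J) 1)
      (single_mem_stdSimplex ℝ _).1 (single_mem_stdSimplex ℝ _).2
    exact ⟨i⟩
  have hs : 0 < ∑ j, g (Pi.single j 1) := by
    rcases hs0.lt_or_eq with h' | h'
    · exact h'
    · exfalso
      have hz : ∀ j, g (Pi.single j 1) = 0 := fun j =>
        (Finset.sum_eq_zero_iff_of_nonneg (fun j _ => hpos j)).1 h'.symm j (Finset.mem_univ j)
      have := hrow (Classical.arbitrary I)
      simp [hz] at this hc
      linarith
  obtain ⟨i, hi⟩ := h (fun j => g (Pi.single j 1) / ∑ j, g (Pi.single j 1))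
    (fun j => div_nonneg (hpos j) hs0) (by rw [← Finset.sum_div]; exact div_self hs.ne')
  have h4 : ∑ j, g (Pi.single j 1) / (∑ j, g (Pi.single j 1)) * M i j
      = (∑ j, M i j * g (Pi.single j 1)) / ∑ j, g (Pi.single j 1) := by
    rw [Finset.sum_div]
    apply Finset.sum_congr rfl
    intros; ring
  rw [h4, le_div_iff₀ hs] at hi
  linarith [hrow i]

theorem disc_aux {X Y : Type} [Fintype X] [Fintype Y] (f μ : X × Y → ℝ)
    (h0 : ∀ p, 0 ≤ μ p) (h1 : ∑ p, μ p = 1) :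
    ∃ (A : Finset X) (B : Finset Y), disc f ≤ |∑ x ∈ A, ∑ y ∈ B, μ (x, y) * f (x, y)| := by
  have hle : disc f ≤ discMu f μ := by
    apply csInf_le
    · refine ⟨0, ?_⟩
      rintro _ ⟨ν, -, -, rfl⟩
      apply Real.sSup_nonneg
      rintro _ ⟨A, B, rfl⟩
      exact abs_nonneg _
    · exact ⟨μ, h0, h1, rfl⟩
  have hmem : discMu f μ ∈ { d : ℝ | ∃ (A : Finset X) (B : Finset Y),
      d = |∑ x ∈ A, ∑ y ∈ B, μ (x, y) * f (x, y)| } := by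
    apply Set.Nonempty.csSup_mem
    · exact ⟨_, ∅, ∅, rfl⟩
    · apply (Set.finite_range (fun R : Finset X × Finset Y =>
        |∑ x ∈ R.1, ∑ y ∈ R.2, μ (x, y) * f (x, y)|)).subset
      rintro _ ⟨A, B, rfl⟩
      exact ⟨(A, B), rfl⟩
  obtain ⟨A, B, hAB⟩ := hmem
  exact ⟨A, B, hAB ▸ hle⟩

/-- if `disc f = δ` and `f` attains both values, there is a probability
distribution `ρ` on rectangles such that every `1`-input is covered with probability
exceeding that of every `(-1)`-input by at least `(2/3)·δ`. -/
theorem exists_distribution_on_rectangles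
    {X Y : Type} [Fintype X] [Fintype Y] [DecidableEq X] [DecidableEq Y]
    (f : X × Y → ℝ) (hf : ∀ p, f p = 1 ∨ f p = -1)
    (δ : ℝ) (hδ : disc f = δ)
    (h1 : ∃ p, f p = 1) (h2 : ∃ p, f p = -1) :
    ∃ ρ : Finset X × Finset Y → ℝ,
      (∀ R, 0 ≤ ρ R) ∧ (∑ R : Finset X × Finset Y, ρ R = 1) ∧
      ∀ p₁ p₂ : X × Y, f p₁ = 1 → f p₂ = -1 →
        (∑ R : Finset X × Finset Y,
            ρ R * (if p₁.1 ∈ R.1 ∧ p₁.2 ∈ R.2 then (1 : ℝ) else 0)) -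
        (∑ R : Finset X × Finset Y,
            ρ R * (if p₂.1 ∈ R.1 ∧ p₂.2 ∈ R.2 then (1 : ℝ) else 0)) ≥
          (2 / 3) * δ := by
  classical
  subst hδ
  obtain ⟨q₁, hq₁⟩ := h1
  obtain ⟨q₂, hq₂⟩ := h2
  have : Nonempty ({p // f p = 1} × {p // f p = -1}) := ⟨⟨⟨q₁, hq₁⟩, ⟨q₂, hq₂⟩⟩⟩
  let e : Finset X × Finset Y → X × Y → ℝ := fun R p => if p.1 ∈ R.1 ∧ p.2 ∈ R.2 then 1 else 0
  obtain ⟨ρ, hρ0, hρ1, hρ⟩ := minimax_aux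
    (I := Finset X × Finset Y) (J := {p // f p = 1} × {p // f p = -1})
    (fun R j => e R j.1 - e R j.2) (2 / 3 * disc f) (by
      intro ν hν0 hν1
      let μ : X × Y → ℝ := fun p => ∑ j : {p // f p = 1} × {p // f p = -1},
        ν j * (((if j.1.1 = p then 1 else 0) + (if j.2.1 = p then 1 else 0)) / 2)
      have hμ0 : ∀ p, 0 ≤ μ p := by
        intro p
        apply Finset.sum_nonneg
        intro j _
        apply mul_nonneg (hν0 j)
        positivity
      have hμ1 : ∑ p, μ p = 1 := by
        simp only [μ]
        rw [Finset.sum_comm]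
        refine Eq.trans ?_ hν1
        apply Finset.sum_congr rfl
        intro j _
        rw [← Finset.mul_sum, ← Finset.sum_div, Finset.sum_add_distrib]
        simp
      have hsum : ∀ (A : Finset X) (B : Finset Y),
          ∑ x ∈ A, ∑ y ∈ B, μ (x, y) * f (x, y)
            = (∑ j, ν j * (e (A, B) j.1 - e (A, B) j.2)) / 2 := by
        intro A B
        rw [← Finset.sum_product']
        simp only [μ, Finset.sum_mul]
        rw [Finset.sum_comm, Finset.sum_div]
        apply Finset.sum_congr rfl
        rintro ⟨⟨a, ha⟩, ⟨b, hb⟩⟩ _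
        have h3 : ∀ p : X × Y, ν (⟨a, ha⟩, ⟨b, hb⟩) *
            (((if a = p then 1 else 0) + (if b = p then 1 else 0)) / 2) * f p
            = ν (⟨a, ha⟩, ⟨b, hb⟩) / 2 *
              ((if a = p then 1 else 0) - (if b = p then 1 else 0)) := by
          intro p
          by_cases hap : a = p
          · by_cases hbp : b = p
            · exfalso; rw [hap] at ha; rw [hbp] at hb; linarith
            · rw [← hap, ha]; rw [← hap] at hbp; simp [hbp]; ring
          · by_cases hbp : b = p
            · rw [← hbp, hb]; rw [← hbp] at hap; simp [hap]; ring
            · simp [hap, hbp]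
        have h4 := Finset.sum_congr (rfl : A ×ˢ B = A ×ˢ B) (fun p _ => h3 p)
        refine Eq.trans h4 ?_
        rw [← Finset.mul_sum, Finset.sum_sub_distrib]
        simp only [Finset.sum_ite_eq, Finset.mem_product, e]
        ring
      obtain ⟨A, B, hAB⟩ := disc_aux f μ hμ0 hμ1
      rw [hsum] at hAB
      have hcomp : (∑ j, ν j * (e (A, B) j.1 - e (A, B) j.2))
          + (∑ j, ν j * (e (Aᶜ, B) j.1 - e (Aᶜ, B) j.2))
          + (∑ j, ν j * (e (A, Bᶜ) j.1 - e (A, Bᶜ) j.2))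
          + (∑ j, ν j * (e (Aᶜ, Bᶜ) j.1 - e (Aᶜ, Bᶜ) j.2)) = 0 := by
        rw [← Finset.sum_add_distrib, ← Finset.sum_add_distrib, ← Finset.sum_add_distrib]
        apply Finset.sum_eq_zero
        intro j _
        have h5 : ∀ p : X × Y, e (A, B) p + e (Aᶜ, B) p + e (A, Bᶜ) p + e (Aᶜ, Bᶜ) p = 1 := by
          intro p
          by_cases ha : p.1 ∈ A <;> by_cases hb : p.2 ∈ B <;> simp [e, ha, hb]
        linear_combination ν j * h5 j.1 - ν j * h5 j.2
      by_contra hno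
      push Not at hno
      have k0 := hno (A, B)
      have k1 := hno (Aᶜ, B)
      have k2 := hno (A, Bᶜ)
      have k3 := hno (Aᶜ, Bᶜ)
      have kE := hno (∅, ∅)
      simp only [e, Finset.notMem_empty, false_and, if_false, sub_self, mul_zero,
        Finset.sum_const_zero] at kE
      rcases le_abs.1 hAB with h6 | h6 <;> linarith)
  refine ⟨ρ, hρ0, hρ1, ?_⟩
  intro p₁ p₂ hp₁ hp₂
  have := hρ (⟨p₁, hp₁⟩, ⟨p₂, hp₂⟩)
  simp only [mul_sub, Finset.sum_sub_distrib] at this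
  exact this
end

section
/- Let M be a real matrix indexed by (X₁ ⊕ X₂) × (Y₁ ⊕ Y₂), written in block form M = [[R, S], [P, Q]] where R is the X₁ × Y₁ block, S the X₁ × Y₂ block, P the X₂ × Y₁ block, and Q the X₂ × Y₂ block. If rank(R) ≤ 1, then rank(S) + rank(P) ≤ rank(M) + 1. -/
open Module in
lemma aux_restrict {V W U : Type*} [AddCommGroup V] [Module ℝ V] [AddCommGroup W] [Module ℝ W]
    [AddCommGroup U] [Module ℝ U] [FiniteDimensional ℝ V]
    (P : V →ₗ[ℝ] W) (R : V →ₗ[ℝ] U) :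
    finrank ℝ (LinearMap.range P) ≤
      finrank ℝ ((LinearMap.ker R).map P) + finrank ℝ (LinearMap.range R) := by
  have h1 := LinearMap.finrank_range_add_finrank_ker P
  have h2 := LinearMap.finrank_range_add_finrank_ker R
  have h3 := LinearMap.finrank_range_add_finrank_ker (P.domRestrict (LinearMap.ker R))
  rw [LinearMap.range_domRestrict] at h3
  have h4 : finrank ℝ (LinearMap.ker (P.domRestrict (LinearMap.ker R))) ≤
      finrank ℝ (LinearMap.ker P) := by
    refine LinearMap.finrank_le_finrank_of_injective
      (f := LinearMap.codRestrict (LinearMap.ker P)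
        ((LinearMap.ker R).subtype ∘ₗ (LinearMap.ker (P.domRestrict (LinearMap.ker R))).subtype)
        ?_) ?_
    · rintro ⟨x, hx⟩
      simpa using hx
    · intro x y h
      apply Subtype.ext
      apply Subtype.ext
      have hval := congrArg Subtype.val h
      exact hval
  omega

/-- for a block matrix `M = [[R, S], [P, Q]]`, if `rank R ≤ 1` then
`rank S + rank P ≤ rank M + 1`. -/
theorem rank_blocks_le
    {X₁ X₂ Y₁ Y₂ : Type} [Fintype X₁] [Fintype X₂] [Fintype Y₁] [Fintype Y₂]
    (M : Matrix (X₁ ⊕ X₂) (Y₁ ⊕ Y₂) ℝ)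
    (hR : (M.submatrix Sum.inl Sum.inl).rank ≤ 1) :
    (M.submatrix Sum.inl Sum.inr).rank + (M.submatrix Sum.inr Sum.inl).rank
      ≤ M.rank + 1 := by
  have h1 := aux_restrict (M.submatrix Sum.inr Sum.inl).mulVecLin
    (M.submatrix Sum.inl Sum.inl).mulVecLin
  let p₁ : (X₁ ⊕ X₂ → ℝ) →ₗ[ℝ] (X₁ → ℝ) := LinearMap.funLeft ℝ ℝ Sum.inl
  let p₂ : (X₁ ⊕ X₂ → ℝ) →ₗ[ℝ] (X₂ → ℝ) := LinearMap.funLeft ℝ ℝ Sum.inr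
  let f := p₁.domRestrict (LinearMap.range M.mulVecLin)
  have h2 := LinearMap.finrank_range_add_finrank_ker f
  have h3 : LinearMap.range (M.submatrix Sum.inl Sum.inr).mulVecLin ≤ LinearMap.range f := by
    rintro _ ⟨u, rfl⟩
    refine ⟨⟨M.mulVecLin (Sum.elim 0 u), _, rfl⟩, ?_⟩
    ext i
    simp [f, p₁, LinearMap.funLeft, Matrix.mulVec, dotProduct]
  have h4 : (LinearMap.ker (M.submatrix Sum.inl Sum.inl).mulVecLin).map
      (M.submatrix Sum.inr Sum.inl).mulVecLin ≤
      (LinearMap.ker f).map (p₂.domRestrict (LinearMap.range M.mulVecLin)) := by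
    rintro _ ⟨u, hu, rfl⟩
    refine ⟨⟨M.mulVecLin (Sum.elim u 0), _, rfl⟩, ?_, ?_⟩
    · ext i
      have := congrFun (LinearMap.mem_ker.1 hu) i
      simpa [f, p₁, LinearMap.funLeft, Matrix.mulVec, dotProduct] using this
    · ext i
      simp [p₂, LinearMap.funLeft, Matrix.mulVec, dotProduct]
  have h5 := Submodule.finrank_mono h3
  have h6 := Submodule.finrank_mono h4
  have h7 := Submodule.finrank_map_le (p₂.domRestrict (LinearMap.range M.mulVecLin))
    (LinearMap.ker f)
  unfold Matrix.rank at *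
  omega
end

section
/- Let M be an n × n real matrix with rank(M) = r ≥ 1 such that every r × r submatrix of M is nonsingular. Suppose M = L + S where rank(L) < r. Then there do not exist sets A, B ⊆ [n] with |A| ≥ r and |B| ≥ r such that S_{a,b} = 0 for all a ∈ A and b ∈ B. -/
/-- if `M` is an `n × n` matrix of rank `r ≥ 1` all of whose `r × r`
submatrices are nonsingular, and `M = L + S` with `rank L < r`, then `S` has no
zero rectangle `A × B` with `|A|, |B| ≥ r`. -/
theorem no_large_zero_rectangle
    {n : ℕ} (M L S : Matrix (Fin n) (Fin n) ℝ)
    (r : ℕ) (hr : M.rank = r) (hr1 : 1 ≤ r)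
    (hminor : ∀ a b : Fin r → Fin n, Function.Injective a → Function.Injective b →
      (M.submatrix a b).det ≠ 0)
    (hML : M = L + S) (hL : L.rank < r) :
    ¬ ∃ (A B : Finset (Fin n)), r ≤ A.card ∧ r ≤ B.card ∧
        ∀ a ∈ A, ∀ b ∈ B, S a b = 0 := by
  rintro ⟨A, B, hA, hB, hS⟩
  have key : ∀ C : Finset (Fin n), r ≤ C.card →
      ∃ f : Fin r → Fin n, Function.Injective f ∧ ∀ i, f i ∈ C := by
    intro C hC
    obtain ⟨D, hDC, hD⟩ := Finset.exists_subset_card_eq hC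
    exact ⟨D.orderEmbOfFin hD, (D.orderEmbOfFin hD).injective,
      fun i => hDC (D.orderEmbOfFin_mem hD i)⟩
  obtain ⟨a, ha, haA⟩ := key A hA
  obtain ⟨b, hb, hbB⟩ := key B hB
  have hdet := hminor a b ha hb
  have heq : M.submatrix a b = L.submatrix a b := by
    ext i j
    simp [hML, hS _ (haA i) _ (hbB j)]
  rw [heq] at hdet
  have h1 := Matrix.rank_of_isUnit (L.submatrix a b)
    ((Matrix.isUnit_iff_isUnit_det _).2 (isUnit_iff_ne_zero.2 hdet))
  have h2 := Matrix.rank_submatrix_le L a b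
  rw [h1, Fintype.card_fin] at h2
  omega
end

section
/- Let f : X × Y → {-1,1} be a boolean function on finite sets whose associated real matrix has rank r. Then the number of distinct rows of this matrix (i.e., the number of distinct functions y ↦ f(x,y) as x ranges over X) is at most 2^r. -/
/-- a boolean matrix of rank `r` has at most `2^r` distinct rows. -/
theorem distinct_rows_le_two_pow_rank
    {X Y : Type} [Fintype X] [Fintype Y]
    (f : X × Y → ℝ) (hf : ∀ p, f p = 1 ∨ f p = -1)
    (r : ℕ) (hr : (Matrix.of fun x y => f (x, y)).rank = r) :
    Nat.card (Set.range fun x : X => fun y : Y => f (x, y)) ≤ 2 ^ r := by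
  classical
  rw [Matrix.rank_eq_finrank_span_cols] at hr
  subst hr
  obtain ⟨g, hg, hspan, -⟩ := Submodule.exists_fun_fin_finrank_span_eq ℝ
    (Set.range (Matrix.of fun x y => f (x, y)).col)
  choose c hc using hg
  have key : ∀ x x' : X, (∀ i, f (x, c i) = f (x', c i)) → ∀ y, f (x, y) = f (x', y) := by
    intro x x' h y
    have hle : Submodule.span ℝ (Set.range g) ≤
        LinearMap.ker (LinearMap.proj (R := ℝ) (φ := fun _ : X => ℝ) x
          - LinearMap.proj (R := ℝ) (φ := fun _ : X => ℝ) x') := by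
      rw [Submodule.span_le]
      rintro _ ⟨i, rfl⟩
      rw [← hc i]
      simpa [sub_eq_zero] using h i
    rw [hspan] at hle
    have := hle (Submodule.subset_span ⟨y, rfl⟩)
    simpa [sub_eq_zero] using this
  let φ : (Set.range fun x : X => fun y : Y => f (x, y)) → (Fin _ → Bool) :=
    fun ρ i => decide (ρ.1 (c i) = 1)
  have hφ : Function.Injective φ := by
    rintro ⟨_, x, rfl⟩ ⟨_, x', rfl⟩ h
    apply Subtype.ext
    funext y
    refine key x x' (fun i => ?_) y
    have hi : f (x, c i) = 1 ↔ f (x', c i) = 1 := by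
      simpa [φ] using congrFun h i
    rcases hf (x, c i) with h1 | h1 <;> rcases hf (x', c i) with h2 | h2 <;>
      rw [h1, h2] at hi ⊢ <;> norm_num at hi
  refine (Nat.card_le_card_of_injective φ hφ).trans ?_
  simp
end
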